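/- For every N ≥ 1 there exists a bilinear operator R_N: C^∞(T^d;ℝ) × C^∞₀(T^d;ℝ^d) → C^∞₀(T^d;Sym(d)) such that div R_N(f,u) = fu − ⨍_{T^d} fu, and for all p, r, s ∈ [1,∞] with 1/p = 1/s + 1/r there is a constant C (depending on d, p, s, r, N) such that for every λ ∈ ℕ: |R_N(f, u(λ·))|_{L^p(T^d)} ≤ C |u|_{L^s(T^d)} (λ^{−1}|f|_{L^r(T^d)} + λ^{−N}|∇^N f|_{L^r(T^d)}). -/

import Mathlib

open MeasureTheory ENNReal NNReal

noncomputable section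

namespace NonNewtonian

abbrev Pt (d : ℕ) := Fin d → ℝ
abbrev Vec (d : ℕ) := Fin d → ℝ
abbrev Mat (d : ℕ) := Fin d → Fin d → ℝ

/-- The fundamental domain `[0,1]^d` of the torus `T^d = ℝ^d/ℤ^d`. -/
def box (d : ℕ) : Set (Pt d) := Set.Icc 0 1

/-- Lebesgue measure restricted to the fundamental domain. -/
def μbox (d : ℕ) : Measure (Pt d) := volume.restrict (box d)

/-- `ℤ^d`-periodicity (functions on the torus). -/
def ZPer {d : ℕ} {α : Type*} (f : Pt d → α) : Prop :=
  ∀ (x : Pt d) (m : Fin d → ℤ), f (x + fun i => (m i : ℝ)) = f x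

/-- Row-wise divergence of a matrix field. -/
def divMat {d : ℕ} (R : Pt d → Mat d) (x : Pt d) : Vec d :=
  fun i => ∑ j, fderiv ℝ (fun y => R y i j) x (Pi.single j 1)

/-- Smooth, `ℤ^d`-periodic scalar functions on the torus. -/
def AdmissibleScal (d : ℕ) (f : Pt d → ℝ) : Prop :=
  ContDiff ℝ ((⊤:ℕ∞)) f ∧ ZPer f

/-- Smooth, `ℤ^d`-periodic, zero-mean vector fields on the torus. -/
def AdmissibleVec (d : ℕ) (u : Pt d → Vec d) : Prop :=
  ContDiff ℝ ((⊤:ℕ∞)) u ∧ ZPer u ∧ ∀ i, (∫ x in box d, u x i) = 0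

section

variable {d : ℕ}

instance : IsProbabilityMeasure (μbox d) := ⟨by
  simp [μbox, box, Real.volume_Icc_pi]⟩

lemma μbox_eq_restrict_fundamentalDomain :
    μbox d = volume.restrict (ZSpan.fundamentalDomain (Pi.basisFun ℝ (Fin d))) := by
  rw [μbox, ZSpan.fundamentalDomain_pi_basisFun, box, ← Set.pi_univ_Icc]
  exact Measure.restrict_congr_set (Measure.ae_eq_set_pi fun i _ => Ico_ae_eq_Icc.symm)

instance : VAddInvariantMeasure (Submodule.span ℤ (Set.range (Pi.basisFun ℝ (Fin d))))
    (Pt d) volume :=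
  ⟨fun c s _ => measure_preimage_add volume (c : Pt d) s⟩

lemma ZPer.span_vadd {α : Type*} {f : Pt d → α} (hf : ZPer f)
    (g : Submodule.span ℤ (Set.range (Pi.basisFun ℝ (Fin d)))) (x : Pt d) :
    f (g +ᵥ x) = f x := by
  obtain ⟨g, hg⟩ := g
  rw [Module.Basis.mem_span_iff_repr_mem] at hg
  choose m hm using hg
  have : g = fun i => (m i : ℝ) := by
    funext i
    simpa using (hm i).symm
  subst this
  have := hf x m
  rw [add_comm] at this
  exact this

lemma ZPer.comp {α β : Type*} {f : Pt d → α} (hf : ZPer f) (g : α → β) :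
    ZPer (fun x => g (f x)) := fun x m => congrArg g (hf x m)

lemma ZPer.dilate {α : Type*} {f : Pt d → α} (hf : ZPer f) (n : ℕ) :
    ZPer (fun x => f ((n : ℝ) • x)) := fun x m => by
  have := hf ((n : ℝ) • x) (fun i => n * m i)
  simp only at this ⊢
  rw [← this]
  congr 1
  ext i
  simp [mul_add]

/-- Periodic functions are invariant in measure under translations. -/
lemma ZPer.lintegral_shift {F : Pt d → ℝ≥0∞} (hF : ZPer F) (τ : Pt d) :
    ∫⁻ x, F (x + τ) ∂(μbox d) = ∫⁻ x, F x ∂(μbox d) := by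
  have h := ZSpan.isAddFundamentalDomain (Pi.basisFun ℝ (Fin d)) (volume : Measure (Pt d))
  have h2 := h.vadd_of_comm τ
  rw [μbox_eq_restrict_fundamentalDomain, h.setLIntegral_eq h2 F hF.span_vadd]
  have hmp : MeasurePreserving (fun x : Pt d => x + τ) volume volume :=
    measurePreserving_add_right volume τ
  rw [← hmp.setLIntegral_comp_preimage_emb (measurableEmbedding_addRight τ) F]
  congr 2
  ext x
  rw [Set.mem_preimage, ← Set.vadd_mem_vadd_set_iff (a := τ), vadd_eq_add, add_comm]

lemma ZPer.integral_shift {F : Pt d → ℝ} (hF : ZPer F) (τ : Pt d) :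
    ∫ x, F (x + τ) ∂(μbox d) = ∫ x, F x ∂(μbox d) := by
  have h := ZSpan.isAddFundamentalDomain (Pi.basisFun ℝ (Fin d)) (volume : Measure (Pt d))
  have h2 := h.vadd_of_comm τ
  rw [μbox_eq_restrict_fundamentalDomain, h.setIntegral_eq h2 hF.span_vadd]
  have hmp : MeasurePreserving (fun x : Pt d => x + τ) volume volume :=
    measurePreserving_add_right volume τ
  rw [← hmp.setIntegral_preimage_emb (measurableEmbedding_addRight τ) F]
  congr 2
  ext x
  rw [Set.mem_preimage, ← Set.vadd_mem_vadd_set_iff (a := τ), vadd_eq_add, add_comm]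

lemma ZPer.neg_shift {α : Type*} {f : Pt d → α} (hf : ZPer f) : ZPer (fun x => f (-x)) :=
  fun x m => by
    have := hf (-x) (fun i => - m i)
    refine Eq.trans ?_ this
    refine congrArg f ?_
    ext i
    simp [add_comm]

lemma ZPer.integral_sub_left {F : Pt d → ℝ} (hF : ZPer F) (x : Pt d) :
    ∫ s, F (x - s) ∂(μbox d) = ∫ s, F s ∂(μbox d) := by
  have h1 := hF.neg_shift.integral_shift (-x)
  have h1' : ∀ s, -(s + -x) = x - s := fun s => by abel
  simp only [h1'] at h1
  rw [h1]
  -- reflect the unit box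
  have h2 := hF.neg_shift.integral_shift (-1)
  rw [← h2]
  have hmp : MeasurePreserving (fun x : Pt d => 1 - x) volume volume :=
    Measure.measurePreserving_sub_left volume 1
  have hemb : MeasurableEmbedding (fun x : Pt d => 1 - x) :=
    (Homeomorph.subLeft (1 : Pt d)).measurableEmbedding
  rw [μbox, ← hmp.setIntegral_preimage_emb hemb]
  have : (fun x : Pt d => 1 - x) ⁻¹' box d = box d := by
    ext x
    simp only [box, Set.mem_preimage, Set.mem_Icc, sub_nonneg, sub_le_self_iff]
    tauto
  rw [this]
  refine integral_congr_ae (Filter.Eventually.of_forall fun x => ?_)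
  simp [sub_eq_add_neg]

/-- Integer dilations preserve integrals of periodic functions. -/
lemma ZPer.lintegral_dilate {F : Pt d → ℝ≥0∞} (hF : ZPer F) (hm : Measurable F) {n : ℕ}
    (hn : 1 ≤ n) : ∫⁻ x, F ((n : ℝ) • x) ∂(μbox d) = ∫⁻ x, F x ∂(μbox d) := by
  have hn0 : (n : ℝ) ≠ 0 := by positivity
  have key : ∀ c : Pt d, ∫⁻ x, F ((n : ℝ) • x + c) ∂(μbox d)
      = ∫⁻ x, F ((n : ℝ) • x) ∂(μbox d) := fun c => by
    rw [← (hF.dilate n).lintegral_shift ((n : ℝ)⁻¹ • c)]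
    simp [smul_add, smul_smul, hn0]
  calc ∫⁻ x, F ((n : ℝ) • x) ∂(μbox d)
      = ∫⁻ _c, ∫⁻ x, F ((n : ℝ) • x) ∂(μbox d) ∂(μbox d) := by simp
    _ = ∫⁻ c, ∫⁻ x, F ((n : ℝ) • x + c) ∂(μbox d) ∂(μbox d) := by simp_rw [key]
    _ = ∫⁻ x, ∫⁻ c, F ((n : ℝ) • x + c) ∂(μbox d) ∂(μbox d) := by
        refine lintegral_lintegral_swap (Measurable.aemeasurable ?_)
        exact hm.comp (by fun_prop : Measurable fun a : Pt d × Pt d => (n : ℝ) • a.2 + a.1)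
    _ = ∫⁻ _x, ∫⁻ c, F c ∂(μbox d) ∂(μbox d) := by
        refine lintegral_congr fun x => ?_
        simp_rw [add_comm ((n : ℝ) • x)]
        exact hF.lintegral_shift _
    _ = _ := by simp

/-- A continuous periodic function is bounded by its essential supremum over the unit box. -/
lemma enorm_le_eLpNorm_top {E : Type*} [NormedAddCommGroup E] {U : Pt d → E}
    (hU : Continuous U) (hper : ZPer U) (y : Pt d) :
    ‖U y‖ₑ ≤ eLpNorm U ∞ (μbox d) := by
  by_contra! hlt
  set M := eLpNorm U ∞ (μbox d) with hM
  set V : Set (Pt d) := {z | M < ‖U z‖ₑ} with hV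
  have hVo : IsOpen V := isOpen_lt continuous_const hU.enorm
  have h0 : ∫⁻ x, V.indicator 1 x ∂(μbox d) = 0 := by
    rw [lintegral_indicator_one hVo.measurableSet]
    have := ae_le_eLpNormEssSup (f := U) (μ := μbox d)
    rw [← eLpNorm_exponent_top, ae_iff] at this
    simpa only [not_le] using this
  have hind : ZPer (V.indicator (1 : Pt d → ℝ≥0∞)) := fun x m => by
    simp only [Set.indicator, hV, Set.mem_ofPred_eq, hper x m]
    rfl
  set c : Pt d := fun _ => 1 / 2
  rw [← hind.lintegral_shift (y - c)] at h0
  have hWo : IsOpen ((fun x => x + (y - c)) ⁻¹' V ∩ Set.univ.pi fun _ : Fin d => Set.Ioo (0:ℝ) 1) :=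
    (hVo.preimage (by fun_prop)).inter (isOpen_set_pi Set.finite_univ fun _ _ => isOpen_Ioo)
  have hpos := hWo.measure_pos volume ⟨c, by
    simpa [hV] using hlt, by simp [c]; norm_num⟩
  have h3 : ∫⁻ x, V.indicator (1 : Pt d → ℝ≥0∞) (x + (y - c)) ∂(μbox d)
      = μbox d ((fun x => x + (y - c)) ⁻¹' V) := by
    rw [← lintegral_indicator_one (hVo.preimage (by fun_prop)).measurableSet]
    rfl
  rw [h3, μbox, Measure.restrict_apply (hVo.preimage (by fun_prop)).measurableSet] at h0
  refine hpos.ne' (measure_mono_null (Set.inter_subset_inter_right _ ?_) h0)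
  intro x hx
  exact ⟨fun i => (hx i trivial).1.le, fun i => (hx i trivial).2.le⟩

/-- Jensen's inequality for a nonnegative weight, in homogeneous form. -/
lemma lintegral_mul_rpow_le {Z : Type*} [MeasurableSpace Z] (μ : Measure Z) {k f : Z → ℝ≥0∞}
    (hk : AEMeasurable k μ) (hf : AEMeasurable f μ) {q : ℝ} (hq : 1 ≤ q) :
    (∫⁻ z, k z * f z ∂μ) ^ q ≤ (∫⁻ z, k z ∂μ) ^ (q - 1) * ∫⁻ z, k z * f z ^ q ∂μ := by
  rcases hq.eq_or_lt with rfl | hq1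
  · simp
  have hconj := Real.HolderConjugate.conjExponent hq1
  have hq0 : 0 < q := by linarith
  set q' := q.conjExponent with hq'
  have hq'0 : 0 < q' := hconj.symm.pos
  have hsum : 1 / q' + 1 / q = 1 := by
    have := hconj.symm.inv_add_inv_eq_one
    simpa using this
  have h := ENNReal.lintegral_mul_le_Lp_mul_Lq μ hconj.symm
    (hk.pow_const (1 / q')) ((hk.pow_const (1 / q)).mul hf)
  have e1 : ∀ z, ((fun z => k z ^ (1 / q')) * ((fun z => k z ^ (1 / q)) * f)) z = k z * f z := by
    intro z
    simp only [Pi.mul_apply]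
    rw [← mul_assoc, ← ENNReal.rpow_add_of_nonneg _ _ (by positivity) (by positivity), hsum,
      ENNReal.rpow_one]
  have e2 : ∀ z, (k z ^ (1 / q')) ^ q' = k z := fun z => by
    rw [← ENNReal.rpow_mul, one_div_mul_cancel hq'0.ne', ENNReal.rpow_one]
  have e3 : ∀ z, (((fun z => k z ^ (1 / q)) * f) z) ^ q = k z * f z ^ q := fun z => by
    simp only [Pi.mul_apply]
    rw [ENNReal.mul_rpow_of_nonneg _ _ hq0.le, ← ENNReal.rpow_mul, one_div_mul_cancel hq0.ne',
      ENNReal.rpow_one]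
  simp only [e1, e2, e3] at h
  calc (∫⁻ z, k z * f z ∂μ) ^ q
      ≤ ((∫⁻ z, k z ∂μ) ^ (1 / q') * (∫⁻ z, k z * f z ^ q ∂μ) ^ (1 / q)) ^ q := by gcongr
    _ = _ := by
      rw [ENNReal.mul_rpow_of_nonneg _ _ hq0.le, ← ENNReal.rpow_mul, ← ENNReal.rpow_mul,
        one_div_mul_cancel hq0.ne', ENNReal.rpow_one]
      congr 2
      have : 1 / q' = 1 - 1 / q := by linarith
      rw [this]
      field_simp

/-- Minkowski's integral inequality for weighted averages of translates of a periodic function. -/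
lemma eLpNorm_le_of_average {E F Z : Type*} [NormedAddCommGroup E] [NormedAddCommGroup F]
    [MeasurableSpace Z] {μ : Measure Z} [SFinite μ] {G : Pt d → E} {U : Pt d → F}
    (hU : Continuous U) (hper : ZPer U) {k : Z → ℝ≥0∞} (hk : Measurable k)
    {τ : Z → Pt d} (hτ : Measurable τ)
    (h : ∀ x, ‖G x‖ₑ ≤ ∫⁻ z, k z * ‖U (x - τ z)‖ₑ ∂μ) {p : ℝ≥0∞} (hp : 1 ≤ p) :
    eLpNorm G p (μbox d) ≤ (∫⁻ z, k z ∂μ) * eLpNorm U p (μbox d) := by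
  have hmeas : Measurable fun a : Pt d × Z => ‖U (a.1 - τ a.2)‖ₑ :=
    hU.enorm.measurable.comp (by fun_prop)
  rcases eq_or_ne p ∞ with rfl | hptop
  · refine eLpNormEssSup_le_of_ae_enorm_bound (C := _) (Filter.Eventually.of_forall fun x => ?_)
    refine (h x).trans ?_
    rw [← lintegral_mul_const _ hk]
    gcongr
    exact enorm_le_eLpNorm_top hU hper _
  · have hp0 : p ≠ 0 := (zero_lt_one.trans_le hp).ne'
    set q := p.toReal with hq
    have hq1 : 1 ≤ q := by
      rw [hq, ← ENNReal.toReal_one]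
      exact ENNReal.toReal_mono hptop hp
    have hq0 : 0 < q := by linarith
    rw [eLpNorm_eq_lintegral_rpow_enorm_toReal hp0 hptop,
      eLpNorm_eq_lintegral_rpow_enorm_toReal hp0 hptop, ← hq]
    set K := ∫⁻ z, k z ∂μ with hK
    have hper' : ZPer fun x => ‖U x‖ₑ ^ q := hper.comp fun y => ‖y‖ₑ ^ q
    have main : ∫⁻ x, ‖G x‖ₑ ^ q ∂(μbox d) ≤ K ^ q * ∫⁻ x, ‖U x‖ₑ ^ q ∂(μbox d) := by
      calc ∫⁻ x, ‖G x‖ₑ ^ q ∂(μbox d)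
          ≤ ∫⁻ x, K ^ (q - 1) * ∫⁻ z, k z * ‖U (x - τ z)‖ₑ ^ q ∂μ ∂(μbox d) := by
            refine lintegral_mono fun x => ?_
            refine (ENNReal.rpow_le_rpow (h x) hq0.le).trans ?_
            exact lintegral_mul_rpow_le μ hk.aemeasurable
              (hU.enorm.measurable.comp (by fun_prop)).aemeasurable hq1
        _ = K ^ (q - 1) * ∫⁻ x, ∫⁻ z, k z * ‖U (x - τ z)‖ₑ ^ q ∂μ ∂(μbox d) := by
            refine lintegral_const_mul _ (Measurable.lintegral_prod_right'
              (f := fun a : Pt d × Z => k a.2 * ‖U (a.1 - τ a.2)‖ₑ ^ q) ?_)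
            exact (hk.comp measurable_snd).mul (hmeas.pow_const q)
        _ = K ^ (q - 1) * ∫⁻ z, ∫⁻ x, k z * ‖U (x - τ z)‖ₑ ^ q ∂(μbox d) ∂μ := by
            rw [lintegral_lintegral_swap]
            exact ((hk.comp measurable_snd).mul (hmeas.pow_const q)).aemeasurable
        _ = K ^ (q - 1) * ∫⁻ z, k z * ∫⁻ x, ‖U x‖ₑ ^ q ∂(μbox d) ∂μ := by
            congr 1
            refine lintegral_congr fun z => ?_
            have hz : Measurable fun x => ‖U (x - τ z)‖ₑ ^ q :=
              (hmeas.comp measurable_prodMk_right).pow_const q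
            rw [lintegral_const_mul _ hz]
            simp_rw [sub_eq_add_neg]
            rw [hper'.lintegral_shift]
        _ = K ^ q * ∫⁻ x, ‖U x‖ₑ ^ q ∂(μbox d) := by
            rw [lintegral_mul_const _ hk, ← hK, ← mul_assoc]
            congr 1
            nth_rewrite 2 [← ENNReal.rpow_one K]
            rw [← ENNReal.rpow_add_of_nonneg _ _ (by linarith) zero_le_one, sub_add_cancel]
    calc (∫⁻ x, ‖G x‖ₑ ^ q ∂(μbox d)) ^ (1 / q)
        ≤ (K ^ q * ∫⁻ x, ‖U x‖ₑ ^ q ∂(μbox d)) ^ (1 / q) := by gcongr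
      _ = _ := by
        rw [ENNReal.mul_rpow_of_nonneg _ _ (by positivity), ← ENNReal.rpow_mul,
          mul_one_div_cancel hq0.ne', ENNReal.rpow_one]

/-- The `L^p` norm of a periodic function is invariant under integer dilations. -/
lemma eLpNorm_dilate {E : Type*} [NormedAddCommGroup E] {U : Pt d → E}
    (hU : Continuous U) (hper : ZPer U) {n : ℕ} (hn : 1 ≤ n) (p : ℝ≥0∞) :
    eLpNorm (fun x => U ((n : ℝ) • x)) p (μbox d) ≤ eLpNorm U p (μbox d) := by
  rcases eq_or_ne p 0 with rfl | hp0
  · simp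
  rcases eq_or_ne p ∞ with rfl | hptop
  · exact eLpNormEssSup_le_of_ae_enorm_bound
      (Filter.Eventually.of_forall fun x => enorm_le_eLpNorm_top hU hper _)
  · rw [eLpNorm_eq_lintegral_rpow_enorm_toReal hp0 hptop,
      eLpNorm_eq_lintegral_rpow_enorm_toReal hp0 hptop]
    have hper' : ZPer fun x => ‖U x‖ₑ ^ p.toReal := hper.comp fun y => ‖y‖ₑ ^ p.toReal
    rw [hper'.lintegral_dilate (hU.enorm.measurable.pow_const _) hn]

lemma ZPer.exists_norm_le {E : Type*} [NormedAddCommGroup E] {U : Pt d → E}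
    (hper : ZPer U) (hU : Continuous U) : ∃ M : ℝ, ∀ y, ‖U y‖ ≤ M := by
  obtain ⟨M, hM⟩ := (isCompact_Icc (a := (0 : Pt d)) (b := 1)).exists_bound_of_continuousOn
    hU.continuousOn
  refine ⟨M, fun y => ?_⟩
  rw [← hper y (fun i => - ⌊y i⌋)]
  refine hM _ ⟨fun i => ?_, fun i => ?_⟩
  · simp [Int.floor_le]
  · have := Int.lt_floor_add_one (y i)
    simp only [Pi.add_apply, Int.cast_neg, Pi.one_apply]
    linarith

/-- Partial derivative in the `j`-th coordinate direction. -/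
def pd (j : Fin d) (f : Pt d → ℝ) : Pt d → ℝ := fun x => fderiv ℝ f x (Pi.single j 1)

lemma AdmissibleScal.differentiable {f : Pt d → ℝ} (hf : AdmissibleScal d f) :
    Differentiable ℝ f := hf.1.differentiable (by simp)

lemma AdmissibleScal.continuous {f : Pt d → ℝ} (hf : AdmissibleScal d f) :
    Continuous f := hf.1.continuous

lemma ZPer.fderiv {E : Type*} [NormedAddCommGroup E] [NormedSpace ℝ E] {f : Pt d → E}
    (hf : ZPer f) : ZPer (fderiv ℝ f) := fun x m => by
  have : f = fun y => f (y + fun i => (m i : ℝ)) := funext fun y => (hf y m).symm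
  conv_rhs => rw [this]
  rw [fderiv_comp_add_right]

lemma AdmissibleScal.pd {f : Pt d → ℝ} (hf : AdmissibleScal d f) (j : Fin d) :
    AdmissibleScal d (pd j f) :=
  ⟨(hf.1.fderiv_right (m := ((⊤ : ℕ∞) : WithTop ℕ∞)) (by simp)).clm_apply contDiff_const,
    hf.2.fderiv.comp fun L => L (Pi.single j 1)⟩

lemma AdmissibleScal.add {f g : Pt d → ℝ} (hf : AdmissibleScal d f) (hg : AdmissibleScal d g) :
    AdmissibleScal d (f + g) :=
  ⟨hf.1.add hg.1, fun x m => congrArg₂ (· + ·) (hf.2 x m) (hg.2 x m)⟩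

lemma AdmissibleScal.sub {f g : Pt d → ℝ} (hf : AdmissibleScal d f) (hg : AdmissibleScal d g) :
    AdmissibleScal d (f - g) :=
  ⟨hf.1.sub hg.1, fun x m => congrArg₂ (· - ·) (hf.2 x m) (hg.2 x m)⟩

lemma AdmissibleScal.mul {f g : Pt d → ℝ} (hf : AdmissibleScal d f) (hg : AdmissibleScal d g) :
    AdmissibleScal d (f * g) :=
  ⟨hf.1.mul hg.1, fun x m => congrArg₂ (· * ·) (hf.2 x m) (hg.2 x m)⟩

lemma AdmissibleScal.const (c : ℝ) : AdmissibleScal d fun _ => c :=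
  ⟨contDiff_const, fun _ _ => rfl⟩

lemma AdmissibleScal.smul {f : Pt d → ℝ} (hf : AdmissibleScal d f) (c : ℝ) :
    AdmissibleScal d (c • f) :=
  ⟨contDiff_const.smul hf.1, fun x m => congrArg (c • ·) (hf.2 x m)⟩

lemma AdmissibleScal.sum {ι : Type*} {s : Finset ι} {f : ι → Pt d → ℝ}
    (hf : ∀ i ∈ s, AdmissibleScal d (f i)) : AdmissibleScal d (∑ i ∈ s, f i) := by
  induction s using Finset.cons_induction with
  | empty => simpa using! AdmissibleScal.const (d := d) 0
  | cons a s ha ih =>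
    rw [Finset.sum_cons]
    exact (hf a (by simp)).add (ih fun i hi => hf i (by simp [hi]))

lemma AdmissibleScal.integrable {f : Pt d → ℝ} (hf : AdmissibleScal d f) :
    Integrable f (μbox d) :=
  hf.continuous.continuousOn.integrableOn_compact isCompact_Icc

lemma pd_add {f g : Pt d → ℝ} (hf : AdmissibleScal d f) (hg : AdmissibleScal d g) (j : Fin d) :
    pd j (f + g) = pd j f + pd j g := by
  funext x
  simp [pd, fderiv_add (hf.differentiable x) (hg.differentiable x)]

lemma pd_sub {f g : Pt d → ℝ} (hf : AdmissibleScal d f) (hg : AdmissibleScal d g) (j : Fin d) :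
    pd j (f - g) = pd j f - pd j g := by
  funext x
  simp [pd, fderiv_sub (hf.differentiable x) (hg.differentiable x)]

lemma pd_mul {f g : Pt d → ℝ} (hf : AdmissibleScal d f) (hg : AdmissibleScal d g) (j : Fin d) :
    pd j (f * g) = f * pd j g + pd j f * g := by
  funext x
  simp only [pd, fderiv_mul (hf.differentiable x) (hg.differentiable x), Pi.add_apply,
    Pi.mul_apply, _root_.add_apply, _root_.smul_apply, smul_eq_mul]
  ring

lemma pd_const (c : ℝ) (j : Fin d) : pd j (fun _ => c) = 0 := by
  funext x
  simp [pd]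

lemma pd_smul {f : Pt d → ℝ} (c : ℝ) (j : Fin d) :
    pd j (c • f) = c • pd j f := by
  funext x
  simp [pd, fderiv_const_smul_field]

lemma pd_sum {ι : Type*} {s : Finset ι} {f : ι → Pt d → ℝ}
    (hf : ∀ i ∈ s, AdmissibleScal d (f i)) (j : Fin d) :
    pd j (∑ i ∈ s, f i) = ∑ i ∈ s, pd j (f i) := by
  funext x
  simp only [pd, Finset.sum_apply]
  rw [fderiv_sum fun i hi => (hf i hi).differentiable x]
  simp

lemma fderiv_eq_sum_pd (f : Pt d → ℝ) (x : Pt d) :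
    fderiv ℝ f x = ∑ j, pd j f x • ContinuousLinearMap.proj (R := ℝ) (φ := fun _ : Fin d => ℝ) j := by
  refine ContinuousLinearMap.coe_injective (LinearMap.pi_ext' fun i => LinearMap.ext_ring ?_)
  simp [pd, Pi.single_apply]

/-- Operators on smooth periodic functions which commute with derivatives, preserve zero mean and
are bounded on every `L^p`. -/
structure NiceOp (T : (Pt d → ℝ) → Pt d → ℝ) : Prop where
  adm : ∀ u, AdmissibleScal d u → AdmissibleScal d (T u)
  pd_comm : ∀ u, AdmissibleScal d u → ∀ j, pd j (T u) = T (pd j u)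
  map_add : ∀ u v, AdmissibleScal d u → AdmissibleScal d v → T (u + v) = T u + T v
  mean : ∀ u, AdmissibleScal d u → ∫ x, u x ∂(μbox d) = 0 → ∫ x, T u x ∂(μbox d) = 0
  bound : ∃ C : ℝ≥0, ∀ p : ℝ≥0∞, 1 ≤ p → ∀ u, AdmissibleScal d u →
    eLpNorm (T u) p (μbox d) ≤ C * eLpNorm u p (μbox d)

lemma NiceOp.comp {S T : (Pt d → ℝ) → Pt d → ℝ} (hS : NiceOp S) (hT : NiceOp T) :
    NiceOp fun u => S (T u) where
  adm u hu := hS.adm _ (hT.adm u hu)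
  pd_comm u hu j := by rw [hS.pd_comm _ (hT.adm u hu), hT.pd_comm u hu]
  map_add u v hu hv := by rw [hT.map_add u v hu hv, hS.map_add _ _ (hT.adm u hu) (hT.adm v hv)]
  mean u hu h := hS.mean _ (hT.adm u hu) (hT.mean u hu h)
  bound := by
    obtain ⟨C, hC⟩ := hS.bound
    obtain ⟨D, hD⟩ := hT.bound
    refine ⟨C * D, fun p hp u hu => (hC p hp _ (hT.adm u hu)).trans ?_⟩
    rw [ENNReal.coe_mul, mul_assoc]
    gcongr
    exact hD p hp u hu

lemma NiceOp.add {S T : (Pt d → ℝ) → Pt d → ℝ} (hS : NiceOp S) (hT : NiceOp T) :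
    NiceOp fun u => S u + T u where
  adm u hu := (hS.adm u hu).add (hT.adm u hu)
  pd_comm u hu j := by rw [pd_add (hS.adm u hu) (hT.adm u hu), hS.pd_comm u hu, hT.pd_comm u hu]
  map_add u v hu hv := by
    rw [hT.map_add u v hu hv, hS.map_add u v hu hv]
    abel
  mean u hu h := by
    have := integral_add (hS.adm u hu).integrable (hT.adm u hu).integrable
    simp only [Pi.add_apply]
    rw [this, hS.mean u hu h, hT.mean u hu h, add_zero]
  bound := by
    obtain ⟨C, hC⟩ := hS.bound
    obtain ⟨D, hD⟩ := hT.bound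
    refine ⟨C + D, fun p hp u hu => ?_⟩
    refine (eLpNorm_add_le (hS.adm u hu).continuous.aestronglyMeasurable
      (hT.adm u hu).continuous.aestronglyMeasurable hp).trans ?_
    rw [ENNReal.coe_add, add_mul]
    exact add_le_add (hC p hp u hu) (hD p hp u hu)

lemma NiceOp.zero : NiceOp fun _ : Pt d → ℝ => (0 : Pt d → ℝ) where
  adm _ _ := AdmissibleScal.const 0
  pd_comm _ _ j := pd_const 0 j
  map_add _ _ _ _ := by simp
  mean _ _ _ := by simp
  bound := ⟨0, fun p hp u hu => by simp⟩

lemma NiceOp.sum {ι : Type*} {s : Finset ι} {T : ι → (Pt d → ℝ) → Pt d → ℝ}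
    (hT : ∀ i ∈ s, NiceOp (T i)) : NiceOp fun u => ∑ i ∈ s, T i u := by
  induction s using Finset.cons_induction with
  | empty => simpa using NiceOp.zero
  | cons a s ha ih =>
    simp_rw [Finset.sum_cons]
    exact (hT a (by simp)).add (ih fun i hi => hT i (by simp [hi]))

section Avg

variable {Z : Type*} [MeasurableSpace Z] {μ : Measure Z} {k : Z → ℝ} {τ : Z → Pt d}

/-- Weighted average of translates. -/
def avg (μ : Measure Z) (k : Z → ℝ) (τ : Z → Pt d) (u : Pt d → ℝ) : Pt d → ℝ :=
  fun x => ∫ z, k z * u (x - τ z) ∂μ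

lemma integrable_avg (hk : Integrable k μ) (hτ : Measurable τ) {u : Pt d → ℝ}
    (hu : AdmissibleScal d u) (x : Pt d) : Integrable (fun z => k z * u (x - τ z)) μ := by
  obtain ⟨M, hM⟩ := hu.2.exists_norm_le hu.continuous
  refine hk.mul_bdd (c := M) ?_ (Filter.Eventually.of_forall fun z => hM _)
  exact (hu.continuous.measurable.comp (by fun_prop)).aestronglyMeasurable

lemma hasFDerivAt_avg (hk : Integrable k μ) (hτ : Measurable τ) {u : Pt d → ℝ}
    (hu : AdmissibleScal d u) (x : Pt d) :
    HasFDerivAt (avg μ k τ u) (∫ z, k z • fderiv ℝ u (x - τ z) ∂μ) x := by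
  have hc : Continuous (fderiv ℝ u) := hu.1.continuous_fderiv (by simp)
  obtain ⟨M, hM⟩ := hu.2.fderiv.exists_norm_le hc
  have hsm : StronglyMeasurable fun z => fderiv ℝ u (x - τ z) :=
    (hc.measurable.comp (by fun_prop : Measurable fun z => x - τ z)).stronglyMeasurable
  refine hasFDerivAt_integral_of_dominated_of_fderiv_le (bound := fun z => ‖k z‖ * M)
    (F' := fun x z => k z • fderiv ℝ u (x - τ z))
    Filter.univ_mem (Filter.Eventually.of_forall fun y => (integrable_avg hk hτ hu y).1)
    (integrable_avg hk hτ hu x) (hk.1.smul hsm.aestronglyMeasurable) ?_ (hk.norm.mul_const M) ?_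
  · refine Filter.Eventually.of_forall fun z y _ => ?_
    rw [norm_smul]
    gcongr
    exact hM _
  · refine Filter.Eventually.of_forall fun z y _ => ?_
    have h := (hu.differentiable (y - τ z)).hasFDerivAt.comp y
      ((hasFDerivAt_id (𝕜 := ℝ) y).sub_const (τ z))
    exact h.const_mul (k z)

lemma pd_avg (hk : Integrable k μ) (hτ : Measurable τ) {u : Pt d → ℝ}
    (hu : AdmissibleScal d u) (j : Fin d) : pd j (avg μ k τ u) = avg μ k τ (pd j u) := by
  funext x
  have hc : Continuous (fderiv ℝ u) := hu.1.continuous_fderiv (by simp)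
  obtain ⟨M, hM⟩ := hu.2.fderiv.exists_norm_le hc
  have hsm : StronglyMeasurable fun z => fderiv ℝ u (x - τ z) :=
    (hc.measurable.comp (by fun_prop : Measurable fun z => x - τ z)).stronglyMeasurable
  have h_int : Integrable (fun z => k z • fderiv ℝ u (x - τ z)) μ :=
    hk.smul_bdd M hsm.aestronglyMeasurable (Filter.Eventually.of_forall fun z => hM _)
  rw [pd, (hasFDerivAt_avg hk hτ hu x).fderiv, ContinuousLinearMap.integral_apply h_int]
  rfl

lemma contDiff_avg (hk : Integrable k μ) (hτ : Measurable τ) (n : ℕ) : ∀ {u : Pt d → ℝ},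
    AdmissibleScal d u → ContDiff ℝ n (avg μ k τ u) := by
  induction n with
  | zero =>
    intro u hu
    exact contDiff_zero.2 (continuous_iff_continuousAt.2 fun x =>
      (hasFDerivAt_avg hk hτ hu x).continuousAt)
  | succ n ih =>
    intro u hu
    rw [Nat.cast_succ, contDiff_succ_iff_fderiv]
    refine ⟨fun x => (hasFDerivAt_avg hk hτ hu x).differentiableAt, by simp, ?_⟩
    have : fderiv ℝ (avg μ k τ u) = fun x => ∑ j, avg μ k τ (pd j u) x •
        ContinuousLinearMap.proj (R := ℝ) (φ := fun _ : Fin d => ℝ) j := by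
      funext x
      rw [fderiv_eq_sum_pd]
      simp_rw [pd_avg hk hτ hu]
    rw [this]
    exact ContDiff.sum fun j _ => (ih (hu.pd j)).smul contDiff_const

lemma niceOp_avg [SFinite μ] (hk : Integrable k μ) (hkm : Measurable k) (hτ : Measurable τ) :
    NiceOp (avg μ k τ) where
  adm u hu := by
    refine ⟨contDiff_infty.2 fun n => contDiff_avg hk hτ n hu, fun x m => ?_⟩
    simp only [avg]
    refine integral_congr_ae (Filter.Eventually.of_forall fun z => ?_)
    have := hu.2 (x - τ z) m
    simp only
    rw [← this, add_sub_right_comm]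
  pd_comm u hu j := pd_avg hk hτ hu j
  map_add u v hu hv := by
    funext x
    simp only [avg, Pi.add_apply, mul_add]
    exact integral_add (integrable_avg hk hτ hu x) (integrable_avg hk hτ hv x)
  mean u hu h := by
    simp only [avg]
    obtain ⟨M, hM⟩ := hu.2.exists_norm_le hu.continuous
    rw [integral_integral_swap]
    · have : ∀ z, ∫ x, k z * u (x - τ z) ∂(μbox d) = 0 := fun z => by
        rw [integral_const_mul]
        simp_rw [sub_eq_add_neg]
        rw [hu.2.integral_shift, h, mul_zero]
      simp [this]
    · refine Integrable.mul_bdd (c := M) (hk.comp_snd (μbox d)) ?_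
        (Filter.Eventually.of_forall fun z => hM _)
      exact (hu.continuous.measurable.comp (by fun_prop)).aestronglyMeasurable
  bound := by
    refine ⟨(∫⁻ z, ‖k z‖ₑ ∂μ).toNNReal, fun p hp u hu => ?_⟩
    rw [ENNReal.coe_toNNReal hk.2.ne]
    refine eLpNorm_le_of_average hu.continuous hu.2 hkm.enorm hτ (fun x => ?_) hp
    refine (enorm_integral_le_lintegral_enorm _).trans_eq ?_
    simp_rw [enorm_mul]

end Avg

/-- Smooth periodic functions of zero mean. -/
def AdmissibleZero (d : ℕ) (u : Pt d → ℝ) : Prop :=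
  AdmissibleScal d u ∧ ∫ x, u x ∂(μbox d) = 0

lemma NiceOp.admissibleZero {T : (Pt d → ℝ) → Pt d → ℝ} (hT : NiceOp T) {u : Pt d → ℝ}
    (hu : AdmissibleZero d u) : AdmissibleZero d (T u) :=
  ⟨hT.adm u hu.1, hT.mean u hu.1 hu.2⟩

lemma avg_box_eq_const {u : Pt d → ℝ} (hu : ZPer u) :
    avg (μbox d) 1 id u = fun _ => ∫ x, u x ∂(μbox d) := by
  funext x
  simp only [avg, Pi.one_apply, one_mul, id]
  exact hu.integral_sub_left x

lemma niceOp_avg_box : NiceOp (avg (μbox d) 1 id) :=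
  niceOp_avg (integrable_const (1 : ℝ)) measurable_one measurable_id

lemma integral_pd {u : Pt d → ℝ} (hu : AdmissibleScal d u) (j : Fin d) :
    ∫ x, pd j u x ∂(μbox d) = 0 := by
  have h := congrFun (niceOp_avg_box.pd_comm u hu j) 0
  rw [avg_box_eq_const hu.2, avg_box_eq_const (hu.pd j).2, pd_const] at h
  exact h.symm

lemma AdmissibleScal.pd_zero {u : Pt d → ℝ} (hu : AdmissibleScal d u) (j : Fin d) :
    AdmissibleZero d (NonNewtonian.pd j u) := ⟨hu.pd j, integral_pd hu j⟩

/-- Components of an order `-1` right inverse of the divergence (on zero-mean functions). -/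
def antiDiv (l : Fin d) : (Pt d → ℝ) → Pt d → ℝ :=
  avg ((μbox d).prod (volume.restrict (Set.Ioc (0 : ℝ) 1))) (fun z => z.1 l) (fun z => z.2 • z.1)

lemma integrable_antiDiv_kernel (l : Fin d) : Integrable (fun z : Pt d × ℝ => z.1 l)
    ((μbox d).prod (volume.restrict (Set.Ioc (0 : ℝ) 1))) := by
  have : Integrable (fun s : Pt d => s l) (μbox d) :=
    (continuous_apply l).continuousOn.integrableOn_compact isCompact_Icc
  exact this.comp_fst _

lemma niceOp_antiDiv (l : Fin d) : NiceOp (antiDiv l) :=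
  niceOp_avg (integrable_antiDiv_kernel l) (by fun_prop) (by fun_prop)

lemma hasDerivAt_line {u : Pt d → ℝ} (hu : AdmissibleScal d u) (x s : Pt d) (θ : ℝ) :
    HasDerivAt (fun θ : ℝ => u (x - θ • s)) (-∑ l, s l * pd l u (x - θ • s)) θ := by
  have h1 : HasDerivAt (fun θ : ℝ => x - θ • s) (-s) θ := by
    simpa using ((hasDerivAt_id θ).smul_const s).const_sub x
  have h2 := (hu.differentiable (x - θ • s)).hasFDerivAt.comp_hasDerivAt θ h1
  have e : fderiv ℝ u (x - θ • s) (-s) = -∑ l, s l * pd l u (x - θ • s) := by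
    rw [fderiv_eq_sum_pd]
    simp [mul_comm]
  rw [e] at h2
  exact h2

lemma sum_pd_antiDiv {u : Pt d → ℝ} (hu : AdmissibleZero d u) :
    ∑ l, pd l (antiDiv l u) = u := by
  funext x
  have h_int : ∀ l : Fin d, Integrable (fun z : Pt d × ℝ => z.1 l * pd l u (x - z.2 • z.1))
      ((μbox d).prod (volume.restrict (Set.Ioc (0 : ℝ) 1))) := fun l =>
    integrable_avg (integrable_antiDiv_kernel l) (by fun_prop) (hu.1.pd l) x
  have hline : ∀ s : Pt d, ∫ θ in Set.Ioc (0 : ℝ) 1, ∑ l, s l * pd l u (x - θ • s)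
      = u x - u (x - s) := fun s => by
    rw [← intervalIntegral.integral_of_le zero_le_one]
    have h := intervalIntegral.integral_eq_sub_of_hasDerivAt (a := 0) (b := 1)
      (fun θ _ => (hasDerivAt_line hu.1 x s θ).neg) ?_
    · simpa [neg_add_eq_sub] using h
    · refine Continuous.intervalIntegrable ?_ _ _
      have := fun l => (hu.1.pd l).continuous
      fun_prop
  have hi : Integrable (fun s => u (x - s)) (μbox d) :=
    (hu.1.continuous.comp (by fun_prop)).continuousOn.integrableOn_compact isCompact_Icc
  rw [Finset.sum_apply]
  simp_rw [(niceOp_antiDiv _).pd_comm u hu.1]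
  simp only [antiDiv, avg]
  rw [← integral_finsetSum _ fun l _ => h_int l,
    integral_prod _ (integrable_finsetSum _ fun l _ => h_int l)]
  simp only [hline]
  rw [integral_sub (integrable_const _) hi, hu.1.2.integral_sub_left, hu.2]
  simp

/-- Smooth compactly supported kernels. -/
def IsBump (ψ : Pt d → ℝ) : Prop := ContDiff ℝ ((⊤ : ℕ∞)) ψ ∧ HasCompactSupport ψ

lemma IsBump.continuous {ψ : Pt d → ℝ} (h : IsBump ψ) : Continuous ψ := h.1.continuous

lemma IsBump.integrable {ψ : Pt d → ℝ} (h : IsBump ψ) : Integrable ψ :=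
  h.continuous.integrable_of_hasCompactSupport h.2

lemma IsBump.pd {ψ : Pt d → ℝ} (h : IsBump ψ) (j : Fin d) : IsBump (pd j ψ) :=
  ⟨(h.1.fderiv_right (m := ((⊤ : ℕ∞) : WithTop ℕ∞)) (by simp)).clm_apply contDiff_const,
    h.2.fderiv_apply (𝕜 := ℝ) _⟩

lemma IsBump.coord_mul {ψ : Pt d → ℝ} (h : IsBump ψ) (i : Fin d) : IsBump fun y => y i * ψ y :=
  ⟨(contDiff_apply ℝ ℝ i).mul h.1, h.2.mul_left⟩

/-- Average at scale `h` against the kernel `ψ`. -/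
def scaleAvg (ψ : Pt d → ℝ) (h : ℝ) : (Pt d → ℝ) → Pt d → ℝ :=
  avg volume ψ fun y => h • y

lemma niceOp_scaleAvg {ψ : Pt d → ℝ} (hψ : IsBump ψ) (h : ℝ) : NiceOp (scaleAvg ψ h) :=
  niceOp_avg hψ.integrable hψ.continuous.measurable (by fun_prop)

lemma integrable_scaleAvg {ψ : Pt d → ℝ} (hψ : IsBump ψ) (h : ℝ) {u : Pt d → ℝ}
    (hu : AdmissibleScal d u) (x : Pt d) : Integrable fun y => ψ y * u (x - h • y) :=
  integrable_avg hψ.integrable (by fun_prop) hu x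

lemma scaleAvg_pd {ψ : Pt d → ℝ} (hψ : IsBump ψ) {h : ℝ} (hh : h ≠ 0) {w : Pt d → ℝ}
    (hw : AdmissibleScal d w) (l : Fin d) (x : Pt d) :
    scaleAvg ψ h (pd l w) x = h⁻¹ * scaleAvg (pd l ψ) h w x := by
  have hg : ∀ y : Pt d, HasFDerivAt (fun y => w (x - h • y))
      ((fderiv ℝ w (x - h • y)).comp (-(h • ContinuousLinearMap.id ℝ (Pt d)))) y := fun y =>
    (hw.differentiable (x - h • y)).hasFDerivAt.comp y
      (((hasFDerivAt_id (𝕜 := ℝ) y).const_smul h).const_sub x)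
  have hgl : ∀ y : Pt d, fderiv ℝ (fun y => w (x - h • y)) y (Pi.single l 1)
      = -h * pd l w (x - h • y) := fun y => by
    rw [(hg y).fderiv]
    simp [pd]
  have key := integral_mul_fderiv_eq_neg_fderiv_mul_of_integrable (μ := (volume : Measure (Pt d)))
    (f := ψ) (g := fun y => w (x - h • y)) (v := Pi.single l 1)
    (integrable_scaleAvg (hψ.pd l) h hw x) ?_ (integrable_scaleAvg hψ h hw x)
    (fun y _ => hψ.1.differentiable (by simp) y) (fun y _ => (hg y).differentiableAt)
  · simp only [hgl] at key
    have e : ∀ y, ψ y * (-h * pd l w (x - h • y)) = -h * (ψ y * pd l w (x - h • y)) :=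
      fun y => by ring
    simp only [e] at key
    rw [integral_const_mul, neg_mul, neg_inj] at key
    simp only [scaleAvg, avg]
    rw [eq_inv_mul_iff_mul_eq₀ hh]
    exact key
  · simp only [hgl]
    have e : ∀ y, ψ y * (-h * pd l w (x - h • y)) = -h * (ψ y * pd l w (x - h • y)) :=
      fun y => by ring
    simp only [e]
    exact (integrable_scaleAvg hψ h (hw.pd l) x).const_mul _

lemma NiceOp.map_sum {T : (Pt d → ℝ) → Pt d → ℝ} (hT : NiceOp T) {ι : Type*} (s : Finset ι)
    {u : ι → Pt d → ℝ} (hu : ∀ i, AdmissibleScal d (u i)) :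
    T (∑ i ∈ s, u i) = ∑ i ∈ s, T (u i) := by
  have h0 : T 0 = 0 := by
    have := hT.map_add 0 0 (AdmissibleScal.const 0) (AdmissibleScal.const 0)
    simpa using this
  induction s using Finset.cons_induction with
  | empty => simpa using h0
  | cons a s ha ih =>
    rw [Finset.sum_cons, Finset.sum_cons,
      hT.map_add _ _ (hu a) (AdmissibleScal.sum fun i _ => hu i), ih]

lemma scaleAvg_eq_inv_mul {ψ : Pt d → ℝ} (hψ : IsBump ψ) {h : ℝ} (hh : h ≠ 0) {u : Pt d → ℝ}
    (hu : AdmissibleZero d u) (x : Pt d) :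
    scaleAvg ψ h u x = h⁻¹ * ∑ l, scaleAvg (pd l ψ) h (antiDiv l u) x := by
  conv_lhs => rw [← sum_pd_antiDiv hu]
  rw [(niceOp_scaleAvg hψ h).map_sum _ fun l => ((niceOp_antiDiv l).adm u hu.1).pd l,
    Finset.sum_apply, Finset.mul_sum]
  exact Finset.sum_congr rfl fun l _ => scaleAvg_pd hψ hh ((niceOp_antiDiv l).adm u hu.1) l x

lemma scaleAvg_eq_inv_sq_mul {ψ : Pt d → ℝ} (hψ : IsBump ψ) {h : ℝ} (hh : h ≠ 0) {u : Pt d → ℝ}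
    (hu : AdmissibleZero d u) (x : Pt d) :
    scaleAvg ψ h u x = (h ^ 2)⁻¹ *
      ∑ l, ∑ m, scaleAvg (pd m (pd l ψ)) h (antiDiv m (antiDiv l u)) x := by
  rw [scaleAvg_eq_inv_mul hψ hh hu, sq, mul_inv, mul_assoc]
  congr 1
  rw [Finset.mul_sum]
  exact Finset.sum_congr rfl fun l _ =>
    scaleAvg_eq_inv_mul (hψ.pd l) hh ((niceOp_antiDiv l).admissibleZero hu) x

/-- The integral over all scales of averages against `ψ`. -/
def potential (ψ : Pt d → ℝ) (u : Pt d → ℝ) : Pt d → ℝ :=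
  fun x => ∫ h in Set.Ioi (0 : ℝ), scaleAvg ψ h u x

/-- The contribution of scales below one. -/
def potentialSmall (ψ : Pt d → ℝ) : (Pt d → ℝ) → Pt d → ℝ :=
  avg ((volume.restrict (Set.Ioc (0 : ℝ) 1)).prod volume) (fun z => ψ z.2) (fun z => z.1 • z.2)

/-- Averages over scales above one with quadratic decay. -/
def potentialLarge (χ : Pt d → ℝ) : (Pt d → ℝ) → Pt d → ℝ :=
  avg ((volume.restrict (Set.Ioi (1 : ℝ))).prod volume) (fun z => (z.1 ^ 2)⁻¹ * χ z.2)
    (fun z => z.1 • z.2)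

lemma integrable_potentialSmall_kernel {ψ : Pt d → ℝ} (hψ : IsBump ψ) :
    Integrable (fun z : ℝ × Pt d => ψ z.2) ((volume.restrict (Set.Ioc (0 : ℝ) 1)).prod volume) :=
  hψ.integrable.comp_snd _

lemma integrable_potentialLarge_kernel {χ : Pt d → ℝ} (hχ : IsBump χ) :
    Integrable (fun z : ℝ × Pt d => (z.1 ^ 2)⁻¹ * χ z.2)
      ((volume.restrict (Set.Ioi (1 : ℝ))).prod volume) := by
  have h : IntegrableOn (fun h : ℝ => (h ^ 2)⁻¹) (Set.Ioi 1) := by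
    refine (integrableOn_Ioi_rpow_of_lt (a := -2) (by norm_num) zero_lt_one).congr_fun
      (fun h hh => ?_) measurableSet_Ioi
    have : (0 : ℝ) ≤ h := zero_le_one.trans (le_of_lt hh)
    simp only [Real.rpow_neg this, Real.rpow_two]
  exact h.mul_prod hχ.integrable

lemma niceOp_potentialSmall {ψ : Pt d → ℝ} (hψ : IsBump ψ) : NiceOp (potentialSmall ψ) :=
  niceOp_avg (integrable_potentialSmall_kernel hψ)
    (hψ.continuous.measurable.comp measurable_snd) (by fun_prop)

lemma niceOp_potentialLarge {χ : Pt d → ℝ} (hχ : IsBump χ) : NiceOp (potentialLarge χ) :=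
  niceOp_avg (integrable_potentialLarge_kernel hχ)
    (((measurable_fst.pow_const 2).inv).mul (hχ.continuous.measurable.comp measurable_snd))
    (by fun_prop)

/-- An operator defined on all smooth periodic functions which agrees with `potential` on those
of zero mean. -/
def potentialSplit (ψ : Pt d → ℝ) (u : Pt d → ℝ) : Pt d → ℝ :=
  potentialSmall ψ u +
    ∑ l, ∑ m, potentialLarge (pd m (pd l ψ)) (antiDiv m (antiDiv l u))

lemma niceOp_potentialSplit {ψ : Pt d → ℝ} (hψ : IsBump ψ) : NiceOp (potentialSplit ψ) :=
  (niceOp_potentialSmall hψ).add <| NiceOp.sum fun l _ => NiceOp.sum fun m _ =>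
    (niceOp_potentialLarge ((hψ.pd l).pd m)).comp ((niceOp_antiDiv m).comp (niceOp_antiDiv l))

lemma potentialSmall_apply {ψ : Pt d → ℝ} (hψ : IsBump ψ) {u : Pt d → ℝ}
    (hu : AdmissibleScal d u) (x : Pt d) :
    IntegrableOn (fun h => scaleAvg ψ h u x) (Set.Ioc 0 1) ∧
      potentialSmall ψ u x = ∫ h in Set.Ioc (0 : ℝ) 1, scaleAvg ψ h u x := by
  have h := integrable_avg (integrable_potentialSmall_kernel hψ)
    (by fun_prop : Measurable fun z : ℝ × Pt d => z.1 • z.2) hu x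
  exact ⟨h.integral_prod_left, integral_prod _ h⟩

lemma potentialLarge_apply {χ : Pt d → ℝ} (hχ : IsBump χ) {u : Pt d → ℝ}
    (hu : AdmissibleScal d u) (x : Pt d) :
    IntegrableOn (fun h => (h ^ 2)⁻¹ * scaleAvg χ h u x) (Set.Ioi 1) ∧
      potentialLarge χ u x = ∫ h in Set.Ioi (1 : ℝ), (h ^ 2)⁻¹ * scaleAvg χ h u x := by
  have h := integrable_avg (integrable_potentialLarge_kernel hχ)
    (by fun_prop : Measurable fun z : ℝ × Pt d => z.1 • z.2) hu x
  have e : ∀ h : ℝ, ∫ y, (h ^ 2)⁻¹ * χ y * u (x - h • y) = (h ^ 2)⁻¹ * scaleAvg χ h u x :=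
    fun h => by
      simp_rw [mul_assoc]
      rw [integral_const_mul]
      rfl
  have h1 := h.integral_prod_left
  have h2 := integral_prod _ h
  simp only [e] at h1 h2
  exact ⟨h1, h2⟩

lemma potential_apply {ψ : Pt d → ℝ} (hψ : IsBump ψ) {u : Pt d → ℝ}
    (hu : AdmissibleZero d u) (x : Pt d) :
    IntegrableOn (fun h => scaleAvg ψ h u x) (Set.Ioi 0) ∧
      potential ψ u x = potentialSplit ψ u x := by
  have hD := fun l m => (niceOp_antiDiv m).adm _ ((niceOp_antiDiv l).adm u hu.1)
  obtain ⟨hs1, hs2⟩ := potentialSmall_apply hψ hu.1 x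
  have hl := fun l m => potentialLarge_apply ((hψ.pd l).pd m) (hD l m) x
  have heq : Set.EqOn (fun h => ∑ l, ∑ m, (h ^ 2)⁻¹ *
      scaleAvg (pd m (pd l ψ)) h (antiDiv m (antiDiv l u)) x)
      (fun h => scaleAvg ψ h u x) (Set.Ioi (1 : ℝ)) := fun h hh => by
    simp only [scaleAvg_eq_inv_sq_mul hψ (zero_lt_one.trans hh).ne' hu x, Finset.mul_sum]
  have hs3 : IntegrableOn (fun h => scaleAvg ψ h u x) (Set.Ioi 1) :=
    IntegrableOn.congr_fun (integrable_finsetSum _ fun l _ =>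
      integrable_finsetSum _ fun m _ => (hl l m).1) heq measurableSet_Ioi
  rw [← Set.Ioc_union_Ioi_eq_Ioi (zero_le_one' ℝ)]
  refine ⟨hs1.union hs3, ?_⟩
  rw [potential, ← Set.Ioc_union_Ioi_eq_Ioi (zero_le_one' ℝ),
    setIntegral_union (Set.Ioc_disjoint_Ioi le_rfl) measurableSet_Ioi hs1 hs3, potentialSplit,
    Pi.add_apply, hs2, ← setIntegral_congr_fun measurableSet_Ioi heq,
    integral_finsetSum _ fun l _ => integrable_finsetSum _ fun m _ => (hl l m).1]
  simp only [Finset.sum_apply]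
  congr 1
  refine Finset.sum_congr rfl fun l _ => ?_
  rw [integral_finsetSum _ fun m _ => (hl l m).1]
  exact Finset.sum_congr rfl fun m _ => (hl l m).2.symm

lemma potential_eq {ψ : Pt d → ℝ} (hψ : IsBump ψ) {u : Pt d → ℝ} (hu : AdmissibleZero d u) :
    potential ψ u = potentialSplit ψ u := funext fun x => (potential_apply hψ hu x).2

lemma AdmissibleZero.add {u v : Pt d → ℝ} (hu : AdmissibleZero d u) (hv : AdmissibleZero d v) :
    AdmissibleZero d (u + v) := by
  refine ⟨hu.1.add hv.1, ?_⟩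
  simp only [Pi.add_apply]
  rw [integral_add hu.1.integrable hv.1.integrable, hu.2, hv.2, add_zero]

lemma AdmissibleZero.smul {u : Pt d → ℝ} (hu : AdmissibleZero d u) (c : ℝ) :
    AdmissibleZero d (c • u) := by
  refine ⟨hu.1.smul c, ?_⟩
  simp only [Pi.smul_apply]
  rw [integral_smul, hu.2, smul_zero]

lemma AdmissibleZero.potential {ψ : Pt d → ℝ} (hψ : IsBump ψ) {u : Pt d → ℝ}
    (hu : AdmissibleZero d u) : AdmissibleZero d (potential ψ u) := by
  rw [potential_eq hψ hu]
  exact (niceOp_potentialSplit hψ).admissibleZero hu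

lemma pd_potential {ψ : Pt d → ℝ} (hψ : IsBump ψ) {u : Pt d → ℝ} (hu : AdmissibleZero d u)
    (j : Fin d) : pd j (potential ψ u) = potential ψ (pd j u) := by
  rw [potential_eq hψ hu, potential_eq hψ (hu.1.pd_zero j),
    (niceOp_potentialSplit hψ).pd_comm u hu.1]

lemma potential_add {ψ : Pt d → ℝ} (hψ : IsBump ψ) {u v : Pt d → ℝ} (hu : AdmissibleZero d u)
    (hv : AdmissibleZero d v) : potential ψ (u + v) = potential ψ u + potential ψ v := by
  rw [potential_eq hψ hu, potential_eq hψ hv, potential_eq hψ (hu.add hv),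
    (niceOp_potentialSplit hψ).map_add u v hu.1 hv.1]

lemma potential_smul (ψ : Pt d → ℝ) (c : ℝ) (u : Pt d → ℝ) :
    potential ψ (c • u) = c • potential ψ u := by
  funext x
  simp only [potential, scaleAvg, avg, Pi.smul_apply, smul_eq_mul]
  rw [← integral_const_mul]
  refine integral_congr_ae (Filter.Eventually.of_forall fun h => ?_)
  simp only [← integral_const_mul]
  exact integral_congr_ae (Filter.Eventually.of_forall fun y => by ring)

lemma potential_dilate (ψ : Pt d → ℝ) (u : Pt d → ℝ) {c : ℝ} (hc : 0 < c) :
    potential ψ (fun x => u (c • x)) = c⁻¹ • fun x => potential ψ u (c • x) := by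
  funext x
  have h := integral_comp_mul_left_Ioi (fun h => scaleAvg ψ h u (c • x)) 0 hc
  rw [mul_zero] at h
  simp only [Pi.smul_apply]
  refine Eq.trans ?_ h
  simp only [potential, scaleAvg, avg, smul_sub, mul_smul]

lemma exists_potential_bound {ψ : Pt d → ℝ} (hψ : IsBump ψ) :
    ∃ C : ℝ≥0, ∀ p : ℝ≥0∞, 1 ≤ p → ∀ u, AdmissibleZero d u →
      eLpNorm (potential ψ u) p (μbox d) ≤ C * eLpNorm u p (μbox d) := by
  obtain ⟨C, hC⟩ := (niceOp_potentialSplit hψ).bound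
  exact ⟨C, fun p hp u hu => potential_eq hψ hu ▸ hC p hp u hu.1⟩

/-- Normalised radial kernels. -/
structure IsRadial (φ : Pt d → ℝ) : Prop where
  bump : IsBump φ
  integral_eq : ∫ y, φ y = 1
  radial : ∀ i j y, y i * pd j φ y = y j * pd i φ y

lemma exists_isRadial (d : ℕ) : ∃ φ : Pt d → ℝ, IsRadial φ := by
  let β : ContDiffBump (0 : ℝ) := ⟨1, 2, one_pos, one_lt_two⟩
  let q : Pt d → ℝ := fun y => ∑ i, y i ^ 2
  let φ₀ : Pt d → ℝ := fun y => β (q y)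
  have hq : ContDiff ℝ ((⊤ : ℕ∞)) q := ContDiff.sum fun i _ => (contDiff_apply ℝ ℝ i).pow 2
  have h1 : ContDiff ℝ ((⊤ : ℕ∞)) φ₀ := β.contDiff.comp hq
  have h2 : HasCompactSupport φ₀ := by
    refine HasCompactSupport.intro (K := Metric.closedBall 0 2)
      (isCompact_closedBall _ _) fun y hy => ?_
    have : ∃ i, 2 < |y i| := by
      by_contra! hc
      exact hy (by simpa [pi_norm_le_iff_of_nonneg] using hc)
    obtain ⟨i, hi⟩ := this
    refine β.zero_of_le_dist ?_
    have h4 : y i ^ 2 ≤ q y := Finset.single_le_sum (f := fun i => y i ^ 2)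
      (fun i _ => sq_nonneg _) (Finset.mem_univ i)
    rw [Real.dist_eq, sub_zero]
    refine le_trans ?_ (le_abs_self _)
    have : (2 : ℝ) ^ 2 ≤ y i ^ 2 := by
      rw [← sq_abs (y i)]; gcongr
    show (2 : ℝ) ≤ _
    linarith
  have h3 : 0 < ∫ y, φ₀ y := by
    refine h1.continuous.integral_pos_of_hasCompactSupport_nonneg_nonzero h2
      (fun y => β.nonneg) (x := 0) ?_
    have : φ₀ 0 = 1 := β.one_of_mem_closedBall (by simp [q, β])
    rw [this]; exact one_ne_zero
  have hd : ∀ j y, pd j φ₀ y = deriv β (q y) * (2 * y j) := fun j y => by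
    have e1 : HasFDerivAt q (∑ i, (2 * y i) • ContinuousLinearMap.proj (R := ℝ)
        (φ := fun _ : Fin d => ℝ) i) y := by
      refine HasFDerivAt.fun_sum fun i _ => ?_
      simpa using (hasFDerivAt_apply (𝕜 := ℝ) i y).pow 2
    have e2 : HasDerivAt β (deriv β (q y)) (q y) :=
      ((β.contDiff (n := 1)).differentiable (by simp) _).hasDerivAt
    have e3 := e2.comp_hasFDerivAt y e1
    change fderiv ℝ (β ∘ q) y (Pi.single j 1) = _
    rw [e3.fderiv]
    simp [Pi.single_apply]
  refine ⟨(∫ y, φ₀ y)⁻¹ • φ₀, ⟨contDiff_const.smul h1, h2.smul_left⟩, ?_, fun i j y => ?_⟩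
  · simp only [Pi.smul_apply]
    rw [integral_smul, smul_eq_mul, inv_mul_cancel₀ h3.ne']
  · simp only [pd_smul, Pi.smul_apply, smul_eq_mul, hd]
    ring

/-- Components of the gradient of the inverse Laplacian, up to sign. -/
def gradInv (φ : Pt d → ℝ) (i : Fin d) : (Pt d → ℝ) → Pt d → ℝ :=
  potential fun y => y i * φ y

lemma pd_coord_mul {φ : Pt d → ℝ} (hφ : IsBump φ) (i j : Fin d) (y : Pt d) :
    pd j (fun y => y i * φ y) y = y i * pd j φ y + if i = j then φ y else 0 := by
  have h := (hasFDerivAt_apply (𝕜 := ℝ) i y).mul (hφ.1.differentiable (by simp) y).hasFDerivAt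
  have e : pd j (fun y => y i * φ y) y = _ := congrArg (fun L => L (Pi.single j 1)) h.fderiv
  rw [e]
  simp [pd, Pi.single_apply]

lemma pd_gradInv_comm {φ : Pt d → ℝ} (hφ : IsRadial φ) {u : Pt d → ℝ} (hu : AdmissibleZero d u)
    (i j : Fin d) : pd j (gradInv φ i u) = pd i (gradInv φ j u) := by
  have e : pd j (fun y : Pt d => y i * φ y) = pd i (fun y : Pt d => y j * φ y) := by
    funext y
    rw [pd_coord_mul hφ.bump, pd_coord_mul hφ.bump, hφ.radial]
    simp only [eq_comm]
  have hi := hφ.bump.coord_mul i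
  have hj := hφ.bump.coord_mul j
  rw [gradInv, gradInv, pd_potential hi hu, pd_potential hj hu]
  funext x
  refine setIntegral_congr_fun measurableSet_Ioi fun h hh => ?_
  have hh' : h ≠ 0 := (Set.mem_Ioi.1 hh).ne'
  simp only [scaleAvg_pd hi hh' hu.1, scaleAvg_pd hj hh' hu.1, e]

lemma hasDerivAt_scaleAvg {φ : Pt d → ℝ} (hφ : IsBump φ) {u : Pt d → ℝ} (hu : AdmissibleScal d u)
    (x : Pt d) (h : ℝ) : HasDerivAt (fun h => scaleAvg φ h u x)
      (-∑ i, scaleAvg (fun y => y i * φ y) h (pd i u) x) h := by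
  have hM : ∀ i : Fin d, ∃ M, ∀ y, ‖pd i u y‖ ≤ M := fun i =>
    (hu.pd i).2.exists_norm_le (hu.pd i).continuous
  choose M hM using hM
  have hc := hφ.continuous
  have hcu := hu.continuous
  have hcp := fun i => (hu.pd i).continuous
  have key := hasDerivAt_integral_of_dominated_loc_of_deriv_le (μ := (volume : Measure (Pt d)))
    (F := fun h y => φ y * u (x - h • y))
    (F' := fun h y => φ y * -∑ i, y i * pd i u (x - h • y))
    (bound := fun y => ∑ i, ‖y i * φ y‖ * M i) (x₀ := h) (s := Set.univ) Filter.univ_mem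
    (Filter.Eventually.of_forall fun h => (by fun_prop : Continuous _).aestronglyMeasurable)
    (integrable_scaleAvg hφ h hu x) (by fun_prop : Continuous _).aestronglyMeasurable
    (Filter.Eventually.of_forall fun y h _ => ?_)
    (integrable_finsetSum _ fun i _ => (hφ.coord_mul i).integrable.norm.mul_const _)
    (Filter.Eventually.of_forall fun y h _ => (hasDerivAt_line hu x y h).const_mul _)
  · have e : -∑ i, ∫ y, y i * φ y * pd i u (x - h • y)
        = ∫ y, φ y * -∑ i, y i * pd i u (x - h • y) := ?_
    · exact e ▸ key.2
    rw [← integral_finsetSum _ fun i _ => integrable_scaleAvg (hφ.coord_mul i) h (hu.pd i) x,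
      ← integral_neg]
    refine integral_congr_ae (Filter.Eventually.of_forall fun y => ?_)
    simp only [mul_neg, Finset.mul_sum]
    congr 1
    exact Finset.sum_congr rfl fun i _ => by ring
  · rw [mul_neg, norm_neg, Finset.mul_sum]
    refine (norm_sum_le _ _).trans (Finset.sum_le_sum fun i _ => ?_)
    rw [← mul_assoc, norm_mul, mul_comm (φ y)]
    gcongr
    exact hM i _

lemma abs_scaleAvg_le {ψ : Pt d → ℝ} (hψ : IsBump ψ) {u : Pt d → ℝ} {M : ℝ}
    (hM : ∀ y, ‖u y‖ ≤ M) (h : ℝ) (x : Pt d) :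
    ‖scaleAvg ψ h u x‖ ≤ ∫ y, ‖ψ y‖ * M := by
  refine norm_integral_le_of_norm_le (hψ.integrable.norm.mul_const _)
    (Filter.Eventually.of_forall fun y => ?_)
  rw [norm_mul]
  gcongr
  exact hM _

lemma tendsto_scaleAvg_atTop {φ : Pt d → ℝ} (hφ : IsBump φ) {u : Pt d → ℝ}
    (hu : AdmissibleZero d u) (x : Pt d) :
    Filter.Tendsto (fun h => scaleAvg φ h u x) Filter.atTop (nhds 0) := by
  have hb : ∃ K, ∀ h, ‖∑ l, scaleAvg (pd l φ) h (antiDiv l u) x‖ ≤ K := by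
    have hM : ∀ l : Fin d, ∃ M, ∀ y, ‖antiDiv l u y‖ ≤ M := fun l => by
      have := (niceOp_antiDiv l).adm u hu.1
      exact this.2.exists_norm_le this.continuous
    choose M hM using hM
    exact ⟨_, fun h => (norm_sum_le _ _).trans
      (Finset.sum_le_sum fun l _ => abs_scaleAvg_le (hφ.pd l) (hM l) h x)⟩
  obtain ⟨K, hK⟩ := hb
  refine Filter.Tendsto.congr' (f₁ := fun h => h⁻¹ * ∑ l, scaleAvg (pd l φ) h (antiDiv l u) x) ?_ ?_
  · filter_upwards [Filter.eventually_gt_atTop 0] with h hh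
    exact (scaleAvg_eq_inv_mul hφ hh.ne' hu x).symm
  · exact tendsto_inv_atTop_zero.zero_mul_isBoundedUnder_le
      (Filter.isBoundedUnder_of ⟨K, hK⟩)

lemma sum_pd_gradInv {φ : Pt d → ℝ} (hφ : IsRadial φ) {u : Pt d → ℝ} (hu : AdmissibleZero d u) :
    ∑ i, pd i (gradInv φ i u) = u := by
  funext x
  have hi := fun i => potential_apply (hφ.bump.coord_mul i) (hu.1.pd_zero i) x
  have hs : IntegrableOn (fun h => ∑ i, scaleAvg (fun y => y i * φ y) h (pd i u) x)
      (Set.Ioi 0) := integrable_finsetSum _ fun i _ => (hi i).1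
  have key := integral_Ioi_of_hasDerivAt_of_tendsto' (a := 0)
    (fun h _ => hasDerivAt_scaleAvg hφ.bump hu.1 x h) hs.neg
    (tendsto_scaleAvg_atTop hφ.bump hu x)
  have h0 : scaleAvg φ 0 u x = u x := by
    simp [scaleAvg, avg, integral_mul_const, hφ.integral_eq]
  rw [h0, integral_neg, zero_sub, neg_inj,
    integral_finsetSum _ fun i _ => (hi i).1] at key
  rw [Finset.sum_apply, ← key]
  refine Finset.sum_congr rfl fun i _ => ?_
  rw [gradInv, pd_potential (hφ.bump.coord_mul i) hu]
  rfl

lemma AdmissibleZero.sub {u v : Pt d → ℝ} (hu : AdmissibleZero d u) (hv : AdmissibleZero d v) :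
    AdmissibleZero d (u - v) := by
  refine ⟨hu.1.sub hv.1, ?_⟩
  simp only [Pi.sub_apply]
  rw [integral_sub hu.1.integrable hv.1.integrable, hu.2, hv.2, sub_zero]

lemma AdmissibleZero.sum {ι : Type*} {s : Finset ι} {f : ι → Pt d → ℝ}
    (hf : ∀ i ∈ s, AdmissibleZero d (f i)) : AdmissibleZero d (∑ i ∈ s, f i) := by
  induction s using Finset.cons_induction with
  | empty => exact ⟨AdmissibleScal.const 0, by simp⟩
  | cons a s ha ih =>
    rw [Finset.sum_cons]
    exact (hf a (by simp)).add (ih fun i hi => hf i (by simp [hi]))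

lemma AdmissibleScal.sub_integral {f : Pt d → ℝ} (hf : AdmissibleScal d f) :
    AdmissibleZero d fun x => f x - ∫ y, f y ∂(μbox d) := by
  refine ⟨hf.sub (AdmissibleScal.const _), ?_⟩
  rw [integral_sub hf.integrable (integrable_const _)]
  simp

lemma AdmissibleScal.dilate {f : Pt d → ℝ} (hf : AdmissibleScal d f) (n : ℕ) :
    AdmissibleScal d fun x => f ((n : ℝ) • x) :=
  ⟨hf.1.comp (contDiff_const_smul _), hf.2.dilate n⟩

lemma eLpNorm_integral_le {f : Pt d → ℝ} (hf : AdmissibleScal d f) {p : ℝ≥0∞} (hp : 1 ≤ p) :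
    eLpNorm (fun _ : Pt d => ∫ y, f y ∂(μbox d)) p (μbox d) ≤ eLpNorm f p (μbox d) := by
  rw [eLpNorm_const _ (zero_lt_one.trans_le hp).ne' (IsProbabilityMeasure.ne_zero _)]
  simp only [measure_univ, ENNReal.one_rpow, mul_one]
  refine (enorm_integral_le_lintegral_enorm _).trans ?_
  rw [← eLpNorm_one_eq_lintegral_enorm]
  exact eLpNorm_le_eLpNorm_of_exponent_le hp hf.continuous.aestronglyMeasurable

lemma eLpNorm_sub_integral_le {f : Pt d → ℝ} (hf : AdmissibleScal d f) {p : ℝ≥0∞} (hp : 1 ≤ p) :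
    eLpNorm (fun x => f x - ∫ y, f y ∂(μbox d)) p (μbox d) ≤ 2 * eLpNorm f p (μbox d) := by
  refine (eLpNorm_sub_le hf.continuous.aestronglyMeasurable aestronglyMeasurable_const hp).trans ?_
  rw [two_mul]
  gcongr
  exact eLpNorm_integral_le hf hp

lemma eLpNorm_mul_le_mul {f g : Pt d → ℝ} (hf : AdmissibleScal d f) (hg : AdmissibleScal d g)
    {p r s : ℝ≥0∞} (h : 1 / p = 1 / s + 1 / r) :
    eLpNorm (f * g) p (μbox d) ≤ eLpNorm g s (μbox d) * eLpNorm f r (μbox d) := by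
  have : ENNReal.HolderTriple s r p := ⟨by simpa using h.symm⟩
  have := eLpNorm_smul_le_mul_eLpNorm (p := s) (q := r) (r := p) (μ := μbox d)
    hf.continuous.aestronglyMeasurable hg.continuous.aestronglyMeasurable
  rwa [smul_eq_mul, mul_comm g f] at this

/-- A symmetric antidivergence, built from the gradient of the inverse Laplacian. -/
def symAnti (φ : Pt d → ℝ) (u : Fin d → Pt d → ℝ) (i j : Fin d) : Pt d → ℝ :=
  gradInv φ j (u i) + gradInv φ i (u j)
    - (if i = j then (1 : ℝ) else 0) • ∑ l, gradInv φ l (u l)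

lemma symAnti_symm (φ : Pt d → ℝ) (u : Fin d → Pt d → ℝ) (i j : Fin d) :
    symAnti φ u i j = symAnti φ u j i := by
  simp only [symAnti, eq_comm, add_comm]

lemma AdmissibleZero.gradInv {φ : Pt d → ℝ} (hφ : IsRadial φ) (i : Fin d) {u : Pt d → ℝ}
    (hu : AdmissibleZero d u) : AdmissibleZero d (gradInv φ i u) :=
  hu.potential (hφ.bump.coord_mul i)

lemma admissibleZero_symAnti {φ : Pt d → ℝ} (hφ : IsRadial φ) {u : Fin d → Pt d → ℝ}
    (hu : ∀ i, AdmissibleZero d (u i)) (i j : Fin d) : AdmissibleZero d (symAnti φ u i j) :=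
  (((hu i).gradInv hφ j).add ((hu j).gradInv hφ i)).sub
    ((AdmissibleZero.sum fun l _ => (hu l).gradInv hφ l).smul _)

lemma sum_pd_symAnti {φ : Pt d → ℝ} (hφ : IsRadial φ) {u : Fin d → Pt d → ℝ}
    (hu : ∀ i, AdmissibleZero d (u i)) (i : Fin d) : ∑ j, pd j (symAnti φ u i j) = u i := by
  have ha : ∀ k l, AdmissibleScal d (NonNewtonian.gradInv φ k (u l)) :=
    fun k l => ((hu l).gradInv hφ k).1
  have hs : AdmissibleScal d (∑ l, NonNewtonian.gradInv φ l (u l)) :=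
    AdmissibleScal.sum fun l _ => ha l l
  have e : ∀ j, pd j (symAnti φ u i j) = pd j (gradInv φ j (u i)) + pd i (gradInv φ j (u j))
      - (if i = j then (1 : ℝ) else 0) • pd j (∑ l, gradInv φ l (u l)) := fun j => by
    rw [symAnti, pd_sub ((ha _ _).add (ha _ _)) (hs.smul _), pd_add (ha _ _) (ha _ _), pd_smul,
      pd_gradInv_comm hφ (hu j) i j]
  simp only [e, Finset.sum_sub_distrib, Finset.sum_add_distrib]
  rw [sum_pd_gradInv hφ (hu i)]
  simp [pd_sum fun l _ => ha l l]

lemma symAnti_add {φ : Pt d → ℝ} (hφ : IsRadial φ) {u v : Fin d → Pt d → ℝ}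
    (hu : ∀ i, AdmissibleZero d (u i)) (hv : ∀ i, AdmissibleZero d (v i)) :
    symAnti φ (u + v) = symAnti φ u + symAnti φ v := by
  funext i j
  have e : ∀ k l, gradInv φ k (u l + v l) = gradInv φ k (u l) + gradInv φ k (v l) :=
    fun k l => potential_add (hφ.bump.coord_mul k) (hu l) (hv l)
  simp only [symAnti, e, Pi.add_apply, Finset.sum_add_distrib, smul_add]
  abel

lemma symAnti_smul (φ : Pt d → ℝ) (c : ℝ) (u : Fin d → Pt d → ℝ) :
    symAnti φ (c • u) = c • symAnti φ u := by
  funext i j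
  have e : ∀ k l, gradInv φ k (c • u l) = c • gradInv φ k (u l) :=
    fun k l => potential_smul _ c _
  simp only [symAnti, e, Pi.smul_apply, ← Finset.smul_sum, smul_sub, smul_add]
  rw [smul_comm]

/-- Componentwise dilation. -/
def dil (n : ℕ) (u : Fin d → Pt d → ℝ) : Fin d → Pt d → ℝ := fun i x => u i ((n : ℝ) • x)

lemma symAnti_dil (φ : Pt d → ℝ) {n : ℕ} (hn : 1 ≤ n) (u : Fin d → Pt d → ℝ) (i j : Fin d) :
    symAnti φ (dil n u) i j = (n : ℝ)⁻¹ • fun x => symAnti φ u i j ((n : ℝ) • x) := by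
  have hn' : (0 : ℝ) < n := by exact_mod_cast hn
  have e : ∀ k l, gradInv φ k (dil n u l) = (n : ℝ)⁻¹ • fun x => gradInv φ k (u l) ((n : ℝ) • x) :=
    fun k l => potential_dilate _ (u l) hn'
  funext x
  simp only [symAnti, e, Pi.smul_apply, Pi.add_apply, Pi.sub_apply, Finset.sum_apply,
    ← Finset.smul_sum, smul_sub, smul_add]
  rw [smul_comm]

/-- The sum of the `L^p` norms of the components. -/
def compNorm (u : Fin d → Pt d → ℝ) (p : ℝ≥0∞) : ℝ≥0∞ := ∑ i, eLpNorm (u i) p (μbox d)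

lemma exists_symAnti_bound {φ : Pt d → ℝ} (hφ : IsRadial φ) :
    ∃ C : ℝ≥0, ∀ p : ℝ≥0∞, 1 ≤ p → ∀ u : Fin d → Pt d → ℝ, (∀ i, AdmissibleZero d (u i)) →
      ∀ i j, eLpNorm (symAnti φ u i j) p (μbox d) ≤ C * compNorm u p := by
  choose C hC using fun i => exists_potential_bound (hφ.bump.coord_mul i)
  set K := ∑ i, C i
  have hle : ∀ p : ℝ≥0∞, 1 ≤ p → ∀ u : Fin d → Pt d → ℝ, (∀ i, AdmissibleZero d (u i)) →
      ∀ k l, eLpNorm (gradInv φ k (u l)) p (μbox d) ≤ K * eLpNorm (u l) p (μbox d) :=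
    fun p hp u hu k l => (hC k p hp (u l) (hu l)).trans (by
      gcongr
      exact Finset.single_le_sum (f := C) (fun _ _ => zero_le) (Finset.mem_univ k))
  refine ⟨3 * K, fun p hp u hu i j => ?_⟩
  have hm : ∀ k l, AEStronglyMeasurable (gradInv φ k (u l)) (μbox d) := fun k l =>
    ((hu l).gradInv hφ k).1.continuous.aestronglyMeasurable
  have hsing : ∀ l, eLpNorm (u l) p (μbox d) ≤ compNorm u p := fun l =>
    Finset.single_le_sum (f := fun i => eLpNorm (u i) p (μbox d)) (fun _ _ => zero_le)
      (Finset.mem_univ l)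
  have h1 : eLpNorm (∑ l, gradInv φ l (u l)) p (μbox d) ≤ K * compNorm u p := by
    refine (eLpNorm_sum_le (fun l _ => hm l l) hp).trans ?_
    rw [compNorm, Finset.mul_sum]
    exact Finset.sum_le_sum fun l _ => hle p hp u hu l l
  have h2 : eLpNorm ((if i = j then (1 : ℝ) else 0) • ∑ l, gradInv φ l (u l)) p (μbox d)
      ≤ K * compNorm u p := by
    split_ifs
    · rwa [one_smul]
    · rw [zero_smul, eLpNorm_zero]
      exact zero_le
  have hsum : AEStronglyMeasurable (∑ l, gradInv φ l (u l)) (μbox d) :=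
    (AdmissibleScal.sum fun l _ => ((hu l).gradInv hφ l).1).continuous.aestronglyMeasurable
  calc _ ≤ _ := eLpNorm_sub_le ((hm _ _).add (hm _ _)) (hsum.const_smul _) hp
    _ ≤ K * compNorm u p + K * compNorm u p + K * compNorm u p := by
      gcongr
      refine (eLpNorm_add_le (hm _ _) (hm _ _) hp).trans ?_
      gcongr <;> refine (hle p hp u hu _ _).trans ?_ <;> gcongr <;> exact hsing _
    _ = _ := by push_cast; ring

/-- The bilinear antidivergence after `n` integrations by parts, before removing its mean. -/
def biAnti (φ : Pt d → ℝ) : ℕ → (Pt d → ℝ) → (Fin d → Pt d → ℝ) → Fin d → Fin d → Pt d → ℝ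
  | 0, f, u => symAnti φ fun i x => f x * u i x - ∫ y, f y * u i y ∂(μbox d)
  | n + 1, f, u => fun i j => f * symAnti φ u i j
      - ∑ k, biAnti φ n (pd k f) (fun i => symAnti φ u i k) i j

lemma admissibleScal_biAnti {φ : Pt d → ℝ} (hφ : IsRadial φ) (n : ℕ) :
    ∀ {f : Pt d → ℝ} {u : Fin d → Pt d → ℝ}, AdmissibleScal d f → (∀ i, AdmissibleZero d (u i)) →
      ∀ i j, AdmissibleScal d (biAnti φ n f u i j) := by
  induction n with
  | zero =>
    intro f u hf hu i j
    exact (admissibleZero_symAnti hφ (fun i => (hf.mul (hu i).1).sub_integral) i j).1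
  | succ n ih =>
    intro f u hf hu i j
    exact (hf.mul (admissibleZero_symAnti hφ hu i j).1).sub <| AdmissibleScal.sum fun k _ =>
      ih (hf.pd k) (fun i => admissibleZero_symAnti hφ hu i k) i j

lemma biAnti_symm (φ : Pt d → ℝ) (n : ℕ) : ∀ (f : Pt d → ℝ) (u : Fin d → Pt d → ℝ) (i j : Fin d),
    biAnti φ n f u i j = biAnti φ n f u j i := by
  induction n with
  | zero => exact fun f u i j => symAnti_symm φ _ i j
  | succ n ih =>
    intro f u i j
    simp only [biAnti]
    rw [symAnti_symm]
    congr 1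
    exact Finset.sum_congr rfl fun k _ => ih _ _ i j

lemma sum_pd_biAnti {φ : Pt d → ℝ} (hφ : IsRadial φ) (n : ℕ) :
    ∀ {f : Pt d → ℝ} {u : Fin d → Pt d → ℝ}, AdmissibleScal d f → (∀ i, AdmissibleZero d (u i)) →
      ∀ i, ∑ j, pd j (biAnti φ n f u i j) = fun x => f x * u i x - ∫ y, f y * u i y ∂(μbox d) := by
  induction n with
  | zero =>
    intro f u hf hu i
    exact sum_pd_symAnti hφ (fun i => (hf.mul (hu i).1).sub_integral) i
  | succ n ih =>
    intro f u hf hu i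
    have hS := fun i j => (admissibleZero_symAnti hφ hu i j)
    have hb := fun k j => admissibleScal_biAnti hφ n (hf.pd k) (fun i => hS i k) i j
    have e : ∀ j, pd j (biAnti φ (n + 1) f u i j) = f * pd j (symAnti φ u i j)
        + pd j f * symAnti φ u i j
        - ∑ k, pd j (biAnti φ n (pd k f) (fun i => symAnti φ u i k) i j) := fun j => by
      rw [biAnti, pd_sub (hf.mul (hS i j).1) (AdmissibleScal.sum fun k _ => hb k j),
        pd_mul hf (hS i j).1, pd_sum fun k _ => hb k j]
    have hmean : ∑ k, ∫ y, pd k f y * symAnti φ u i k y ∂(μbox d)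
        = - ∫ y, f y * u i y ∂(μbox d) := by
      have h0 : ∀ k, ∫ y, pd k (f * symAnti φ u i k) y ∂(μbox d) = 0 := fun k =>
        integral_pd (hf.mul (hS i k).1) k
      have h1 : ∀ k, ∫ y, pd k f y * symAnti φ u i k y ∂(μbox d)
          = - ∫ y, f y * pd k (symAnti φ u i k) y ∂(μbox d) := fun k => by
        have := h0 k
        rw [pd_mul hf (hS i k).1] at this
        simp only [Pi.add_apply] at this
        rw [integral_add (hf.mul ((hS i k).1.pd k)).integrable
          ((hf.pd k).mul (hS i k).1).integrable] at this
        simp only [Pi.mul_apply] at this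
        linarith
      have h2 := integral_finsetSum (μ := μbox d) Finset.univ
        fun k _ => (hf.mul ((hS i k).1.pd k)).integrable
      simp only [Pi.mul_apply] at h2
      simp only [h1, Finset.sum_neg_distrib]
      rw [← h2]
      simp only [← Finset.mul_sum, ← Finset.sum_apply, sum_pd_symAnti hφ hu]
    simp only [e, Finset.sum_add_distrib, Finset.sum_sub_distrib, ← Finset.mul_sum]
    rw [sum_pd_symAnti hφ hu, Finset.sum_comm]
    simp only [ih (hf.pd _) (fun i => hS i _)]
    funext x
    simp only [Pi.add_apply, Pi.sub_apply, Pi.mul_apply, Finset.sum_apply, Finset.sum_sub_distrib,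
      hmean]
    ring

lemma biAnti_add_left {φ : Pt d → ℝ} (hφ : IsRadial φ) (n : ℕ) :
    ∀ {f g : Pt d → ℝ} {u : Fin d → Pt d → ℝ}, AdmissibleScal d f → AdmissibleScal d g →
      (∀ i, AdmissibleZero d (u i)) → biAnti φ n (f + g) u = biAnti φ n f u + biAnti φ n g u := by
  induction n with
  | zero =>
    intro f g u hf hg hu
    have h1 := fun i => (hf.mul (hu i).1)
    have h2 := fun i => (hg.mul (hu i).1)
    refine Eq.trans ?_
      (symAnti_add hφ (fun i => (h1 i).sub_integral) fun i => (h2 i).sub_integral)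
    rw [biAnti]
    congr 1
    funext i x
    have : ∫ y, (f + g) y * u i y ∂(μbox d)
        = ∫ y, f y * u i y ∂(μbox d) + ∫ y, g y * u i y ∂(μbox d) := by
      refine Eq.trans ?_ (integral_add (h1 i).integrable (h2 i).integrable)
      exact integral_congr_ae (Filter.Eventually.of_forall fun y => add_mul _ _ _)
    rw [this]
    simp only [Pi.add_apply]
    ring
  | succ n ih =>
    intro f g u hf hg hu
    funext i j
    simp only [biAnti, Pi.add_apply, pd_add hf hg,
      ih (hf.pd _) (hg.pd _) (fun i => admissibleZero_symAnti hφ hu i _), Finset.sum_add_distrib]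
    ring

lemma biAnti_add_right {φ : Pt d → ℝ} (hφ : IsRadial φ) (n : ℕ) :
    ∀ {f : Pt d → ℝ} {u v : Fin d → Pt d → ℝ}, AdmissibleScal d f →
      (∀ i, AdmissibleZero d (u i)) → (∀ i, AdmissibleZero d (v i)) →
      biAnti φ n f (u + v) = biAnti φ n f u + biAnti φ n f v := by
  induction n with
  | zero =>
    intro f u v hf hu hv
    have h1 := fun i => (hf.mul (hu i).1)
    have h2 := fun i => (hf.mul (hv i).1)
    refine Eq.trans ?_
      (symAnti_add hφ (fun i => (h1 i).sub_integral) fun i => (h2 i).sub_integral)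
    rw [biAnti]
    congr 1
    funext i x
    have : ∫ y, f y * (u + v) i y ∂(μbox d)
        = ∫ y, f y * u i y ∂(μbox d) + ∫ y, f y * v i y ∂(μbox d) := by
      refine Eq.trans ?_ (integral_add (h1 i).integrable (h2 i).integrable)
      exact integral_congr_ae (Filter.Eventually.of_forall fun y => mul_add _ _ _)
    rw [this]
    simp only [Pi.add_apply]
    ring
  | succ n ih =>
    intro f u v hf hu hv
    funext i j
    have e := fun k => congrFun (congrFun (ih (hf.pd k) (fun i => admissibleZero_symAnti hφ hu i k)
      (fun i => admissibleZero_symAnti hφ hv i k)) i) j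
    simp only [Pi.add_def] at e
    simp only [biAnti, symAnti_add hφ hu hv]
    simp only [Pi.add_def, Pi.sub_def, e]
    funext x
    simp only [Pi.mul_apply, Finset.sum_apply, Finset.sum_add_distrib]
    ring

lemma biAnti_smul_left (φ : Pt d → ℝ) (n : ℕ) (c : ℝ) :
    ∀ (f : Pt d → ℝ) (u : Fin d → Pt d → ℝ), biAnti φ n (c • f) u = c • biAnti φ n f u := by
  induction n with
  | zero =>
    intro f u
    rw [biAnti, biAnti, ← symAnti_smul]
    congr 1
    funext i x
    simp only [Pi.smul_apply, smul_eq_mul, mul_assoc, integral_const_mul, mul_sub]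
  | succ n ih =>
    intro f u
    funext i j
    simp only [biAnti, Pi.smul_apply, pd_smul, ih, ← Finset.smul_sum, smul_sub, smul_mul_assoc]

lemma biAnti_smul_right (φ : Pt d → ℝ) (n : ℕ) (c : ℝ) :
    ∀ (f : Pt d → ℝ) (u : Fin d → Pt d → ℝ), biAnti φ n f (c • u) = c • biAnti φ n f u := by
  induction n with
  | zero =>
    intro f u
    rw [biAnti, biAnti, ← symAnti_smul]
    congr 1
    funext i x
    simp only [Pi.smul_apply, smul_eq_mul, mul_left_comm _ c, integral_const_mul, mul_sub]
  | succ n ih =>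
    intro f u
    funext i j
    have e := fun k => congrFun (congrFun (ih (pd k f) fun i => symAnti φ u i k) i) j
    simp only [Pi.smul_def] at e
    simp only [biAnti, symAnti_smul]
    simp only [Pi.smul_def, Pi.sub_def, e]
    funext x
    simp only [Pi.mul_apply, Finset.sum_apply, ← Finset.smul_sum, smul_sub, mul_smul_comm]

section Interpolation

set_option maxSynthPendingDepth 3

lemma norm_deriv_apply_le_of_second_deriv {E F : Type*} [NormedAddCommGroup E] [NormedSpace ℝ E]
    [NormedAddCommGroup F] [NormedSpace ℝ F] [CompleteSpace F] {g : E → F}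
    {g' : E → E →L[ℝ] F} {g'' : E → E →L[ℝ] E →L[ℝ] F} (hg : ∀ x, HasFDerivAt g (g' x) x)
    (hg' : ∀ x, HasFDerivAt g' (g'' x) x) (hg'' : Continuous g'') (x v : E) :
    ‖g' x v‖ ≤ ‖g (x + v)‖ + ‖g x‖
      + ‖v‖ ^ 2 * ∫ θ in (0 : ℝ)..1, ‖g'' (x + θ • v)‖ := by
  have hline : ∀ θ : ℝ, HasDerivAt (fun θ : ℝ => x + θ • v) v θ := fun θ => by
    simpa using ((hasDerivAt_id θ).smul_const v).const_add x
  have h1 : ∀ θ : ℝ, HasDerivAt (fun θ : ℝ => g (x + θ • v)) (g' (x + θ • v) v) θ :=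
    fun θ => (hg _).comp_hasDerivAt θ (hline θ)
  have h2 : ∀ θ : ℝ, HasDerivAt (fun θ : ℝ => g' (x + θ • v))
      (g'' (x + θ • v) v) θ :=
    fun θ => (hg' _).comp_hasDerivAt θ (hline θ)
  set I := ∫ θ in (0 : ℝ)..1, ‖g'' (x + θ • v)‖
  have hcn : Continuous fun θ : ℝ => ‖g'' (x + θ • v)‖ :=
    (hg''.comp (by fun_prop : Continuous fun θ : ℝ => x + θ • v)).norm
  have h3 : ∀ θ ∈ Set.Ico (0 : ℝ) 1, ‖g' (x + θ • v) v - g' x v‖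
      ≤ ‖v‖ ^ 2 * I := fun θ hθ => by
    have hi := intervalIntegral.integral_eq_sub_of_hasDerivAt (a := 0) (b := θ)
      (fun t _ => h2 t) (Continuous.intervalIntegrable (by fun_prop) _ _)
    have hle : ‖g' (x + θ • v) - g' x‖ ≤ ‖v‖ * I := by
      have : g' (x + θ • v) - g' x
          = ∫ t in (0 : ℝ)..θ, g'' (x + t • v) v := by
        rw [hi]; simp
      rw [this]
      calc _ ≤ ∫ t in (0 : ℝ)..θ, ‖g'' (x + t • v)‖ * ‖v‖ :=
            intervalIntegral.norm_integral_le_of_norm_le hθ.1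
              (Filter.Eventually.of_forall fun t _ => ContinuousLinearMap.le_opNorm _ _)
              (Continuous.intervalIntegrable (by fun_prop) _ _)
        _ ≤ ∫ t in (0 : ℝ)..1, ‖g'' (x + t • v)‖ * ‖v‖ :=
            intervalIntegral.integral_mono_interval le_rfl hθ.1 hθ.2.le
              (Filter.Eventually.of_forall fun t => by positivity)
              (Continuous.intervalIntegrable (by fun_prop) _ _)
        _ = _ := by rw [intervalIntegral.integral_mul_const, mul_comm]
    calc _ = ‖(g' (x + θ • v) - g' x) v‖ := by simp
      _ ≤ _ := ContinuousLinearMap.le_opNorm _ _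
      _ ≤ ‖v‖ * I * ‖v‖ := by gcongr
      _ = _ := by ring
  have h4 := norm_image_sub_le_of_norm_deriv_le_segment_01'
    (f := fun θ : ℝ => g (x + θ • v) - θ • g' x v)
    (fun θ _ => ((h1 θ).sub ((hasDerivAt_id θ).smul_const (g' x v))).hasDerivWithinAt)
    (by simpa using h3)
  simp only [one_smul, zero_smul, add_zero, sub_zero] at h4
  calc ‖g' x v‖ = ‖g (x + v) - g x - (g (x + v) - g' x v - g x)‖ := by
        congr 1; abel
    _ ≤ ‖g (x + v)‖ + ‖g x‖ + ‖g (x + v) - g' x v - g x‖ :=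
        (norm_sub_le _ _).trans (by gcongr; exact norm_sub_le _ _)
    _ ≤ _ := by gcongr

variable {F : Type*} [NormedAddCommGroup F]

lemma eLpNorm_comp_add_right_le {g : Pt d → F} (hg : Continuous g) (hper : ZPer g) (v : Pt d)
    {p : ℝ≥0∞} (hp : 1 ≤ p) :
    eLpNorm (fun x => g (x + v)) p (μbox d) ≤ eLpNorm g p (μbox d) := by
  simpa using eLpNorm_le_of_average (μ := Measure.dirac ()) (G := fun x => g (x + v)) hg hper
    (k := fun _ => 1) measurable_const (τ := fun _ => -v) measurable_const (by simp) hp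

lemma eLpNorm_segment_integral_le {g : Pt d → F} (hg : Continuous g) (hper : ZPer g) (v : Pt d)
    {p : ℝ≥0∞} (hp : 1 ≤ p) :
    eLpNorm (fun x => ∫ θ in (0 : ℝ)..1, ‖g (x + θ • v)‖) p (μbox d) ≤ eLpNorm g p (μbox d) := by
  have := eLpNorm_le_of_average (μ := volume.restrict (Set.Ioc (0 : ℝ) 1))
    (G := fun x => ∫ θ in (0 : ℝ)..1, ‖g (x + θ • v)‖) hg hper (k := fun _ => 1)
    measurable_const (τ := fun θ => -(θ • v)) (by fun_prop) (fun x => ?_) hp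
  · simpa using this
  · rw [intervalIntegral.integral_of_le zero_le_one]
    refine (enorm_integral_le_lintegral_enorm _).trans_eq ?_
    simp

variable [NormedSpace ℝ F]

lemma ofReal_mul_eLpNorm_fderiv_apply_le [CompleteSpace F] {g : Pt d → F} (hg : ContDiff ℝ 2 g)
    (hper : ZPer g) (j : Fin d) {h : ℝ} (hh : 0 ≤ h) {p : ℝ≥0∞} (hp : 1 ≤ p) :
    ENNReal.ofReal h * eLpNorm (fun x => fderiv ℝ g x (Pi.single j 1)) p (μbox d)
      ≤ 2 * eLpNorm g p (μbox d)
        + ENNReal.ofReal h ^ 2 * eLpNorm (fderiv ℝ (fderiv ℝ g)) p (μbox d) := by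
  set v : Pt d := h • Pi.single j 1
  have hv : ‖v‖ = h := by
    simp [v, norm_smul, Pi.norm_single, abs_of_nonneg hh]
  have hg1 : ContDiff ℝ 1 (fderiv ℝ g) := hg.fderiv_right (by norm_num)
  have hc2 : Continuous (fderiv ℝ (fderiv ℝ g)) := hg1.continuous_fderiv (by simp)
  have hc := hg.continuous
  have hseg : Continuous fun x => ∫ θ in (0 : ℝ)..1, ‖fderiv ℝ (fderiv ℝ g) (x + θ • v)‖ :=
    intervalIntegral.continuous_parametric_intervalIntegral_of_continuous'
      (f := fun x θ => ‖fderiv ℝ (fderiv ℝ g) (x + θ • v)‖)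
      (continuous_norm.comp (hc2.comp (by fun_prop : Continuous fun z : Pt d × ℝ => z.1 + z.2 • v)))
      _ _
  have e : ENNReal.ofReal h * eLpNorm (fun x => fderiv ℝ g x (Pi.single j 1)) p (μbox d)
      = eLpNorm (fun x => fderiv ℝ g x v) p (μbox d) := by
    have : (fun x => fderiv ℝ g x v) = h • fun x => fderiv ℝ g x (Pi.single j 1) := by
      funext x; simp [v]
    rw [this, eLpNorm_const_smul, Real.enorm_eq_ofReal hh]
  have e3 : eLpNorm (fun x => h ^ 2 * ∫ θ in (0 : ℝ)..1, ‖fderiv ℝ (fderiv ℝ g) (x + θ • v)‖)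
      p (μbox d) ≤ ENNReal.ofReal h ^ 2 * eLpNorm (fderiv ℝ (fderiv ℝ g)) p (μbox d) := by
    refine (eLpNorm_const_smul (h ^ 2) _ p (μbox d)).trans_le ?_
    rw [enorm_pow, Real.enorm_eq_ofReal hh]
    gcongr
    exact eLpNorm_segment_integral_le hc2 hper.fderiv.fderiv v hp
  rw [e, two_mul]
  calc _ ≤ eLpNorm ((fun x => ‖g (x + v)‖) + (fun x => ‖g x‖) +
        fun x => h ^ 2 * ∫ θ in (0 : ℝ)..1, ‖fderiv ℝ (fderiv ℝ g) (x + θ • v)‖) p (μbox d) := by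
        refine eLpNorm_mono_real fun x => ?_
        have := norm_deriv_apply_le_of_second_deriv
          (fun x => (hg.differentiable (by simp) x).hasFDerivAt)
          (fun x => (hg1.differentiable (by simp) x).hasFDerivAt) hc2 x v
        rwa [hv] at this
    _ ≤ _ := by
        refine (eLpNorm_add_le (by fun_prop : Continuous _).aestronglyMeasurable
          (by fun_prop : Continuous _).aestronglyMeasurable hp).trans ?_
        refine add_le_add ((eLpNorm_add_le (by fun_prop : Continuous _).aestronglyMeasurable
          (by fun_prop : Continuous _).aestronglyMeasurable hp).trans ?_) e3
        rw [eLpNorm_norm, eLpNorm_norm]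
        gcongr
        exact eLpNorm_comp_add_right_le hc hper v hp

lemma norm_le_sum_apply_single (L : Pt d →L[ℝ] F) : ‖L‖ ≤ ∑ j, ‖L (Pi.single j 1)‖ := by
  refine L.opNorm_le_bound (Finset.sum_nonneg fun _ _ => norm_nonneg _) fun v => ?_
  have : L v = ∑ j, v j • L (Pi.single j 1) := by
    conv_lhs => rw [pi_eq_sum_univ' v]
    simp only [map_sum, map_smul]
  rw [this, Finset.sum_mul]
  refine (norm_sum_le _ _).trans (Finset.sum_le_sum fun j _ => ?_)
  rw [norm_smul, mul_comm]
  gcongr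
  exact norm_le_pi_norm v j

lemma ofReal_mul_eLpNorm_fderiv_le [CompleteSpace F] {g : Pt d → F} (hg : ContDiff ℝ 2 g)
    (hper : ZPer g) {h : ℝ} (hh : 0 ≤ h) {p : ℝ≥0∞} (hp : 1 ≤ p) :
    ENNReal.ofReal h * eLpNorm (fderiv ℝ g) p (μbox d)
      ≤ d * (2 * eLpNorm g p (μbox d)
        + ENNReal.ofReal h ^ 2 * eLpNorm (fderiv ℝ (fderiv ℝ g)) p (μbox d)) := by
  have hc : Continuous (fderiv ℝ g) := hg.continuous_fderiv (by simp)
  calc _ ≤ ENNReal.ofReal h * ∑ j, eLpNorm (fun x => fderiv ℝ g x (Pi.single j 1)) p (μbox d) := by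
        gcongr
        calc _ ≤ eLpNorm (∑ j, fun x => ‖fderiv ℝ g x (Pi.single j 1)‖) p (μbox d) := by
              refine eLpNorm_mono_real fun x => ?_
              rw [Finset.sum_apply]
              exact norm_le_sum_apply_single _
          _ ≤ _ := by
              refine (eLpNorm_sum_le (fun j _ =>
                (by fun_prop : Continuous _).aestronglyMeasurable) hp).trans_eq ?_
              simp only [eLpNorm_norm]
    _ ≤ ∑ j : Fin d, (2 * eLpNorm g p (μbox d)
        + ENNReal.ofReal h ^ 2 * eLpNorm (fderiv ℝ (fderiv ℝ g)) p (μbox d)) := by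
        rw [Finset.mul_sum]
        exact Finset.sum_le_sum fun j _ => ofReal_mul_eLpNorm_fderiv_apply_le hg hper j hh hp
    _ = _ := by rw [Finset.sum_const, Finset.card_univ, Fintype.card_fin, nsmul_eq_mul]

end Interpolation

lemma ZPer.iteratedFDeriv {f : Pt d → ℝ} (hf : ZPer f) (k : ℕ) : ZPer (iteratedFDeriv ℝ k f) :=
  fun x m => by
    have : f = fun y => f (y + fun i => (m i : ℝ)) := funext fun y => (hf y m).symm
    conv_rhs => rw [this]
    rw [iteratedFDeriv_comp_add_right]

/-- The `L^r` norm of the `k`-th derivative. -/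
def derivNorm (k : ℕ) (f : Pt d → ℝ) (r : ℝ≥0∞) : ℝ≥0∞ :=
  eLpNorm (fun x => iteratedFDeriv ℝ k f x) r (μbox d)

lemma AdmissibleScal.continuous_iteratedFDeriv {f : Pt d → ℝ} (hf : AdmissibleScal d f) (k : ℕ) :
    Continuous (iteratedFDeriv ℝ k f) :=
  hf.1.continuous_iteratedFDeriv (m := k) (by exact_mod_cast le_top)

lemma derivNorm_zero (f : Pt d → ℝ) (r : ℝ≥0∞) : derivNorm 0 f r = eLpNorm f r (μbox d) :=
  eLpNorm_congr_norm_ae (Filter.Eventually.of_forall fun _ => norm_iteratedFDeriv_zero)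

lemma derivNorm_ne_top {f : Pt d → ℝ} (hf : AdmissibleScal d f) (k : ℕ) (r : ℝ≥0∞) :
    derivNorm k f r ≠ ∞ := by
  obtain ⟨M, hM⟩ := (hf.2.iteratedFDeriv k).exists_norm_le (hf.continuous_iteratedFDeriv k)
  exact (MemLp.of_bound (hf.continuous_iteratedFDeriv k).aestronglyMeasurable M
    (Filter.Eventually.of_forall hM)).eLpNorm_ne_top

lemma derivNorm_pd_le {f : Pt d → ℝ} (hf : AdmissibleScal d f) (k : ℕ) (j : Fin d) (r : ℝ≥0∞) :
    derivNorm k (pd j f) r ≤ derivNorm (k + 1) f r := by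
  refine eLpNorm_mono fun x => ?_
  have hc : ContDiff ℝ k (fderiv ℝ f) := hf.1.fderiv_right (by exact_mod_cast le_top)
  have h := (ContinuousLinearMap.apply ℝ ℝ (Pi.single j 1 : Pt d)).norm_iteratedFDeriv_comp_left
    hc.contDiffAt (x := x) (n := k) le_rfl
  rw [norm_iteratedFDeriv_fderiv] at h
  refine h.trans (mul_le_of_le_one_left (norm_nonneg _) ?_)
  refine ContinuousLinearMap.opNorm_le_bound _ zero_le_one fun L => ?_
  simpa [Pi.norm_single] using L.le_opNorm (Pi.single j 1)

set_option maxSynthPendingDepth 3 in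
lemma norm_fderiv_fderiv_iteratedFDeriv {E F : Type*} [NormedAddCommGroup E] [NormedSpace ℝ E]
    [NormedAddCommGroup F] [NormedSpace ℝ F] (f : E → F) (k : ℕ) (x : E) :
    ‖fderiv ℝ (fderiv ℝ (iteratedFDeriv ℝ k f)) x‖ = ‖iteratedFDeriv ℝ (k + 2) f x‖ := by
  rw [fderiv_iteratedFDeriv, LinearIsometryEquiv.comp_fderiv, ← norm_fderiv_iteratedFDeriv]
  exact LinearIsometry.norm_toContinuousLinearMap_comp (LinearIsometryEquiv.toLinearIsometry _)

set_option maxSynthPendingDepth 3 in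
lemma derivNorm_interpolation {f : Pt d → ℝ} (hf : AdmissibleScal d f) {r : ℝ≥0∞} (hr : 1 ≤ r)
    (k : ℕ) {h : ℝ} (hh : 0 ≤ h) :
    ENNReal.ofReal h * derivNorm (k + 1) f r
      ≤ d * (2 * derivNorm k f r + ENNReal.ofReal h ^ 2 * derivNorm (k + 2) f r) := by
  have hc : ContDiff ℝ 2 (iteratedFDeriv ℝ k f) :=
    (contDiff_infty.1 hf.1 (2 + k)).iteratedFDeriv_right (m := 2) (by norm_cast)
  have key := ofReal_mul_eLpNorm_fderiv_le hc (hf.2.iteratedFDeriv k) hh hr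
  have e1 : eLpNorm (fderiv ℝ (iteratedFDeriv ℝ k f)) r (μbox d) = derivNorm (k + 1) f r :=
    eLpNorm_congr_norm_ae (Filter.Eventually.of_forall fun x => norm_fderiv_iteratedFDeriv)
  have e2 : eLpNorm (fderiv ℝ (fderiv ℝ (iteratedFDeriv ℝ k f))) r (μbox d)
      = derivNorm (k + 2) f r :=
    eLpNorm_congr_norm_ae
      (Filter.Eventually.of_forall fun x => norm_fderiv_fderiv_iteratedFDeriv f k x)
  rwa [e1, e2] at key

lemma exists_interpolation_step {D : ℝ} (hD : 0 ≤ D) (k : ℕ) : ∀ ε : ℝ, 0 < ε → ∃ C : ℝ, 0 ≤ C ∧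
    ∀ A : ℕ → ℝ, (∀ n, 0 ≤ A n) →
      (∀ η : ℝ, 0 < η → ∀ n, η * A (n + 1) ≤ D * (2 * A n + η ^ 2 * A (n + 2))) →
      A k ≤ C * A 0 + ε * A (k + 1) := by
  induction k with
  | zero =>
    intro ε hε
    refine ⟨1, zero_le_one, fun A hA _ => ?_⟩
    have := mul_nonneg hε.le (hA 1)
    simpa using this
  | succ k ih =>
    intro ε hε
    have hD1 : (0 : ℝ) < D + 1 := by linarith
    set η := ε / (2 * (D + 1)) with hη
    have hη0 : 0 < η := by positivity
    obtain ⟨C, hC, h⟩ := ih (η / (4 * (D + 1))) (by positivity)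
    refine ⟨4 * D * C / η, by positivity, fun A hA hi => ?_⟩
    have h1 := h A hA hi
    have h2 := hi η hη0 k
    have h3 : D * (2 * A k) ≤ D * (2 * (C * A 0)) + η / 2 * A (k + 1) := by
      have e : D * (2 * (η / (4 * (D + 1)) * A (k + 1)))
          = η / 2 * A (k + 1) * (D / (D + 1)) := by field_simp; ring
      have e' : D / (D + 1) ≤ 1 := by rw [div_le_one hD1]; linarith
      have e2 : η / 2 * A (k + 1) * (D / (D + 1)) ≤ η / 2 * A (k + 1) :=
        mul_le_of_le_one_right (mul_nonneg (by positivity) (hA _)) e'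
      nlinarith [mul_le_mul_of_nonneg_left h1 hD]
    have h4 : D * (η * η * A (k + 2)) ≤ η * (ε / 2) * A (k + 2) := by
      have e : D * η ≤ ε / 2 := by
        rw [hη, mul_div_assoc', div_le_div_iff₀ (by positivity) (by positivity)]
        nlinarith
      have := mul_le_mul_of_nonneg_right e (mul_nonneg hη0.le (hA (k + 2)))
      nlinarith
    have h5 : η * A (k + 1) ≤ η * (4 * D * C / η * A 0 + ε * A (k + 2)) := by
      have : η * (4 * D * C / η * A 0 + ε * A (k + 2)) = 4 * D * C * A 0 + η * ε * A (k + 2) := by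
        field_simp
      rw [this]
      nlinarith
    exact le_of_mul_le_mul_left h5 hη0

lemma exists_interpolation {D : ℝ} (hD : 0 ≤ D) (N : ℕ) : ∃ C : ℝ, 0 ≤ C ∧
    ∀ A : ℕ → ℝ, (∀ n, 0 ≤ A n) →
      (∀ η : ℝ, 0 < η → ∀ n, η * A (n + 1) ≤ D * (2 * A n + η ^ 2 * A (n + 2))) →
      ∀ k ≤ N, A k ≤ C * (A 0 + A N) := by
  induction N with
  | zero =>
    refine ⟨1, zero_le_one, fun A hA _ k hk => ?_⟩
    obtain rfl := Nat.le_zero.1 hk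
    linarith [hA 0]
  | succ N ih =>
    obtain ⟨C, hC, h⟩ := ih
    obtain ⟨C', hC', h'⟩ := exists_interpolation_step hD N 1 one_pos
    refine ⟨C * (1 + C') + C + 1, by positivity, fun A hA hi k hk => ?_⟩
    have h0 := hA 0
    have h1 := hA (N + 1)
    rcases Nat.of_le_succ hk with hk | rfl
    · have a1 := h A hA hi k hk
      have a2 := mul_le_mul_of_nonneg_left (h' A hA hi) hC
      nlinarith [mul_nonneg hC hC', mul_nonneg (mul_nonneg hC hC') h1, mul_nonneg hC h0,
        mul_nonneg hC h1]
    · have : 0 ≤ C * (1 + C') + C := by positivity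
      nlinarith [mul_nonneg this h1, mul_nonneg this h0]

/-- Intermediate derivatives, measured at scale `Λ`, are controlled by the extreme ones. -/
lemma exists_derivNorm_le (d N : ℕ) : ∃ C : ℝ≥0, ∀ (r : ℝ≥0∞), 1 ≤ r → ∀ f : Pt d → ℝ,
    AdmissibleScal d f → ∀ Λ : ℝ≥0, 0 < Λ → ∀ k ≤ N,
      (Λ : ℝ≥0∞) ^ k * derivNorm k f r ≤ C * (derivNorm 0 f r + (Λ : ℝ≥0∞) ^ N * derivNorm N f r) := by
  obtain ⟨C, hC, h⟩ := exists_interpolation (Nat.cast_nonneg d) N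
  lift C to ℝ≥0 using hC
  refine ⟨C, fun r hr f hf Λ hΛ k hk => ?_⟩
  set b : ℕ → ℝ≥0 := fun n => (derivNorm n f r).toNNReal
  have hb : ∀ n, derivNorm n f r = b n := fun n =>
    (ENNReal.coe_toNNReal (derivNorm_ne_top hf n r)).symm
  have key := h (fun n => (Λ : ℝ) ^ n * b n) (fun n => by positivity) (fun η hη n => by
    have i1 := derivNorm_interpolation hf hr n (h := η * Λ) (by positivity)
    rw [hb, hb, hb] at i1
    lift η to ℝ≥0 using hη.le
    rw [← NNReal.coe_mul, ENNReal.ofReal_coe_nnreal] at i1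
    have i2 : η * Λ * b (n + 1) ≤ d * (2 * b n + (η * Λ) ^ 2 * b (n + 2)) := by exact_mod_cast i1
    have i3 : (η : ℝ) * Λ * b (n + 1) ≤ d * (2 * b n + (η * Λ) ^ 2 * b (n + 2)) := by
      exact_mod_cast i2
    have := mul_le_mul_of_nonneg_left i3 (show (0 : ℝ) ≤ (Λ : ℝ) ^ n by positivity)
    refine (le_of_eq (by ring)).trans (this.trans (le_of_eq (by ring)))) k hk
  simp only [pow_zero, one_mul] at key
  rw [hb, hb, hb]
  have key' : Λ ^ k * b k ≤ C * (b 0 + Λ ^ N * b N) := by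
    rw [← NNReal.coe_le_coe]; exact_mod_cast key
  exact_mod_cast key'

/-- The weighted sum of derivative norms that an `n`-fold integration by parts produces. -/
def scaleNorm (Λ : ℝ≥0∞) (n : ℕ) (b : ℕ → ℝ≥0∞) : ℝ≥0∞ :=
  ∑ k ∈ Finset.range n, Λ ^ (k + 1) * b k + Λ ^ n * b n

lemma scaleNorm_succ (Λ : ℝ≥0∞) (n : ℕ) (b : ℕ → ℝ≥0∞) :
    scaleNorm Λ (n + 1) b = Λ * (b 0 + scaleNorm Λ n fun k => b (k + 1)) := by
  simp only [scaleNorm, Finset.sum_range_succ', mul_add, Finset.mul_sum, pow_succ', pow_zero,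
    mul_assoc]
  ring

lemma scaleNorm_mono (Λ : ℝ≥0∞) (n : ℕ) {b c : ℕ → ℝ≥0∞} (h : ∀ k, b k ≤ c k) :
    scaleNorm Λ n b ≤ scaleNorm Λ n c := by
  unfold scaleNorm
  gcongr <;> apply h

lemma compNorm_symAnti_le {φ : Pt d → ℝ} {C : ℝ≥0} {p : ℝ≥0∞} {u : Fin d → Pt d → ℝ}
    (h : ∀ i j, eLpNorm (symAnti φ u i j) p (μbox d) ≤ C * compNorm u p) (k : Fin d) :
    compNorm (fun i => symAnti φ u i k) p ≤ d * (C * compNorm u p) := by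
  refine (Finset.sum_le_sum fun i _ => h i k).trans ?_
  simp

lemma AdmissibleZero.dilate {f : Pt d → ℝ} (hf : AdmissibleZero d f) {l : ℕ} (hl : 1 ≤ l) :
    AdmissibleZero d fun x => f ((l : ℝ) • x) := by
  have hg := hf.1.dilate l
  refine ⟨hg, ?_⟩
  have h : ∀ g : ℝ → ℝ, Continuous g → ∫⁻ x, ENNReal.ofReal (g (f ((l : ℝ) • x))) ∂(μbox d)
      = ∫⁻ x, ENNReal.ofReal (g (f x)) ∂(μbox d) := fun g hc =>
    ZPer.lintegral_dilate (F := fun x => ENNReal.ofReal (g (f x)))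
      (hf.1.2.comp fun y => ENNReal.ofReal (g y))
      (ENNReal.continuous_ofReal.comp (hc.comp hf.1.continuous)).measurable hl
  have h_id := h id continuous_id
  simp only [id] at h_id
  rw [← hf.2, integral_eq_lintegral_pos_part_sub_lintegral_neg_part hg.integrable,
    integral_eq_lintegral_pos_part_sub_lintegral_neg_part hf.1.integrable,
    h_id, h _ continuous_neg]

lemma exists_biAnti_bound {φ : Pt d → ℝ} (hφ : IsRadial φ) {p r s : ℝ≥0∞} (hp : 1 ≤ p)
    (hs : 1 ≤ s) (hprs : 1 / p = 1 / s + 1 / r) (n : ℕ) :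
    ∃ C : ℝ≥0, ∀ f : Pt d → ℝ, AdmissibleScal d f → ∀ u : Fin d → Pt d → ℝ,
      (∀ i, AdmissibleZero d (u i)) → ∀ l : ℕ, 1 ≤ l → ∀ i j,
        eLpNorm (biAnti φ n f (dil l u) i j) p (μbox d)
          ≤ C * compNorm u s * scaleNorm (l : ℝ≥0∞)⁻¹ n (fun k => derivNorm k f r) := by
  obtain ⟨K, hK⟩ := exists_symAnti_bound hφ
  have hmul : ∀ {f w : Pt d → ℝ}, AdmissibleScal d f → AdmissibleScal d w → ∀ l : ℕ, 1 ≤ l →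
      eLpNorm (f * fun x => w ((l : ℝ) • x)) p (μbox d)
        ≤ eLpNorm w s (μbox d) * derivNorm 0 f r := fun {f w} hf hw l hl => by
    rw [derivNorm_zero]
    refine (eLpNorm_mul_le_mul hf (hw.dilate l) hprs).trans ?_
    exact mul_le_mul_left (eLpNorm_dilate hw.continuous hw.2 hl s) _
  induction n with
  | zero =>
    refine ⟨K * 2, fun f hf u hu l hl i j => ?_⟩
    have hfu : ∀ i, AdmissibleScal d (f * fun x => u i ((l : ℝ) • x)) :=
      fun i => hf.mul ((hu i).1.dilate l)
    refine (hK p hp _ (fun i => (hfu i).sub_integral) i j).trans ?_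
    have : ∀ i, eLpNorm (fun x => f x * dil l u i x - ∫ y, f y * dil l u i y ∂(μbox d)) p (μbox d)
        ≤ 2 * (eLpNorm (u i) s (μbox d) * derivNorm 0 f r) := fun i =>
      (eLpNorm_sub_integral_le (hfu i) hp).trans (by gcongr; exact hmul hf (hu i).1 l hl)
    refine (mul_le_mul_right (Finset.sum_le_sum fun i _ => this i) _).trans (le_of_eq ?_)
    rw [← Finset.mul_sum, ← Finset.sum_mul]
    simp only [scaleNorm, compNorm, Finset.range_zero, Finset.sum_empty, pow_zero, zero_add,
      one_mul]
    push_cast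
    ring
  | succ n ih =>
    obtain ⟨C, hC⟩ := ih
    refine ⟨K + d * (C * (d * K)), fun f hf u hu l hl i j => ?_⟩
    have hS := fun i j => admissibleZero_symAnti hφ hu i j
    have hl0 : (l : ℝ) ≠ 0 := by positivity
    have e : biAnti φ (n + 1) f (dil l u) i j
        = (l : ℝ)⁻¹ • (f * (fun x => symAnti φ u i j ((l : ℝ) • x))
          - ∑ k, biAnti φ n (pd k f) (dil l fun i => symAnti φ u i k) i j) := by
      have e1 : ∀ k, (fun i => symAnti φ (dil l u) i k)
          = (l : ℝ)⁻¹ • dil l fun i => symAnti φ u i k := fun k => by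
        funext i
        rw [symAnti_dil φ hl]
        rfl
      simp only [biAnti, e1, biAnti_smul_right, Pi.smul_apply]
      rw [symAnti_dil φ hl]
      rw [smul_sub, Finset.smul_sum, mul_smul_comm]
    have hl1 : ‖(l : ℝ)⁻¹‖ₑ = (l : ℝ≥0∞)⁻¹ := by
      rw [enorm_inv hl0]
      congr 1
      simp
    have hlz : ∀ k, ∀ i, AdmissibleZero d (dil l (fun i => symAnti φ u i k) i) :=
      fun k i => (hS i k).dilate hl
    have hb := fun k => admissibleScal_biAnti hφ n (hf.pd k) (hlz k) i j
    have hSn := hK s hs u hu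
    rw [e, eLpNorm_const_smul, hl1, scaleNorm_succ]
    have h1 : eLpNorm (f * fun x => symAnti φ u i j ((l : ℝ) • x)) p (μbox d)
        ≤ K * compNorm u s * derivNorm 0 f r :=
      (hmul hf (hS i j).1 l hl).trans (by gcongr; exact hSn i j)
    have h2 : ∀ k, eLpNorm (biAnti φ n (pd k f) (dil l fun i => symAnti φ u i k) i j) p (μbox d)
        ≤ C * (d * (K * compNorm u s))
          * scaleNorm (l : ℝ≥0∞)⁻¹ n (fun k => derivNorm (k + 1) f r) := fun k =>
      (hC (pd k f) (hf.pd k) _ (fun i => hS i k) l hl i j).trans (by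
        gcongr
        · exact compNorm_symAnti_le hSn k
        · exact scaleNorm_mono _ _ fun m => derivNorm_pd_le hf m k r)
    have h3 : eLpNorm (∑ k, biAnti φ n (pd k f) (dil l fun i => symAnti φ u i k) i j) p (μbox d)
        ≤ d * (C * (d * (K * compNorm u s))
          * scaleNorm (l : ℝ≥0∞)⁻¹ n (fun k => derivNorm (k + 1) f r)) := by
      refine (eLpNorm_sum_le (fun k _ => (hb k).continuous.aestronglyMeasurable) hp).trans ?_
      refine (Finset.sum_le_sum fun k _ => h2 k).trans ?_
      simp
    have h4 := (eLpNorm_sub_le ((hf.mul ((hS i j).1.dilate l)).continuous.aestronglyMeasurable)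
      (AdmissibleScal.sum fun k _ => hb k).continuous.aestronglyMeasurable hp).trans
      (add_le_add h1 h3)
    refine (mul_le_mul_right h4 _).trans ?_
    set B := scaleNorm (l : ℝ≥0∞)⁻¹ n (fun k => derivNorm (k + 1) f r)
    set b := derivNorm 0 f r
    set U := compNorm u s
    set L := (l : ℝ≥0∞)⁻¹
    have : ((K + d * (C * (d * K)) : ℝ≥0) : ℝ≥0∞) = K + d * (C * (d * K)) := by push_cast; rfl
    rw [this]
    calc L * (K * U * b + d * (C * (d * (K * U)) * B))
        = U * L * (K * b + (d * (C * (d * K))) * B) := by ring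
      _ ≤ U * L * ((K + d * (C * (d * K))) * b + (K + d * (C * (d * K))) * B) := by
        gcongr
        · exact le_self_add
        · exact le_add_self
      _ = (K + d * (C * (d * K))) * U * (L * (b + B)) := by ring

/-- The weighted sum collapses to its extreme terms by interpolation. -/
lemma exists_scaleNorm_le (d N : ℕ) : ∃ C : ℝ≥0, ∀ r : ℝ≥0∞, 1 ≤ r →
    ∀ f : Pt d → ℝ, AdmissibleScal d f → ∀ l : ℕ, 1 ≤ l →
      scaleNorm (l : ℝ≥0∞)⁻¹ N (fun k => derivNorm k f r)
        ≤ C * ((l : ℝ≥0∞)⁻¹ * derivNorm 0 f r + (l : ℝ≥0∞)⁻¹ ^ N * derivNorm N f r) := by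
  obtain ⟨C, hC⟩ := exists_derivNorm_le d N
  refine ⟨N * C + 1, fun r hr f hf l hl => ?_⟩
  have hl0 : (0 : ℝ≥0) < l := by exact_mod_cast hl
  have hΛ : (l : ℝ≥0∞)⁻¹ = ((l : ℝ≥0)⁻¹ : ℝ≥0) := by
    rw [ENNReal.coe_inv hl0.ne', ENNReal.coe_natCast]
  have h := hC r hr f hf (l : ℝ≥0)⁻¹ (inv_pos.2 hl0)
  rw [← hΛ] at h
  have hL1 : (l : ℝ≥0∞)⁻¹ ≤ 1 := ENNReal.inv_le_one.2 (by exact_mod_cast hl)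
  set L := (l : ℝ≥0∞)⁻¹
  have hsum : ∀ k ∈ Finset.range N, L ^ (k + 1) * derivNorm k f r
      ≤ C * (L * derivNorm 0 f r + L ^ N * derivNorm N f r) := fun k hk => by
    calc L ^ (k + 1) * derivNorm k f r = L * (L ^ k * derivNorm k f r) := by ring
      _ ≤ L * (C * (derivNorm 0 f r + L ^ N * derivNorm N f r)) := by
        exact mul_le_mul_right (h k (Finset.mem_range.1 hk).le) _
      _ = C * (L * derivNorm 0 f r + L * (L ^ N * derivNorm N f r)) := by ring
      _ ≤ _ := by
        exact mul_le_mul_right (add_le_add_right (mul_le_of_le_one_left zero_le hL1) _) _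
  unfold scaleNorm
  refine (add_le_add (Finset.sum_le_sum hsum) (le_add_self :
    L ^ N * derivNorm N f r ≤ L * derivNorm 0 f r + L ^ N * derivNorm N f r)).trans (le_of_eq ?_)
  rw [Finset.sum_const, Finset.card_range, nsmul_eq_mul]
  push_cast
  ring

/-- The components of a vector field. -/
def comps (u : Pt d → Vec d) : Fin d → Pt d → ℝ := fun i x => u x i

lemma AdmissibleVec.comps {u : Pt d → Vec d} (hu : AdmissibleVec d u) (i : Fin d) :
    AdmissibleZero d (comps u i) :=
  ⟨⟨contDiff_pi.1 hu.1 i, hu.2.1.comp fun v => v i⟩, hu.2.2 i⟩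

lemma compNorm_comps_le (u : Pt d → Vec d) (s : ℝ≥0∞) :
    compNorm (comps u) s ≤ d * eLpNorm u s (μbox d) := by
  refine (Finset.sum_le_sum fun i _ => eLpNorm_mono (g := u) fun x => norm_le_pi_norm (u x) i).trans
    (le_of_eq ?_)
  simp

lemma eLpNorm_mat_le {R : Pt d → Mat d} {p : ℝ≥0∞} (hp : 1 ≤ p)
    (hR : ∀ i j, Continuous fun x => R x i j) {K : ℝ≥0∞}
    (hK : ∀ i j, eLpNorm (fun x => R x i j) p (μbox d) ≤ K) :
    eLpNorm R p (μbox d) ≤ d * (d * K) := by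
  have h : ∀ x, ‖R x‖ ≤ ∑ i, ∑ j, ‖R x i j‖ := fun x => by
    have h0 : ∀ i, 0 ≤ ∑ j, ‖R x i j‖ := fun i => Finset.sum_nonneg fun j _ => norm_nonneg _
    refine (pi_norm_le_iff_of_nonneg (Finset.sum_nonneg fun i _ => h0 i)).2 fun i => ?_
    refine le_trans ?_ (Finset.single_le_sum (fun i _ => h0 i) (Finset.mem_univ i))
    exact (pi_norm_le_iff_of_nonneg (h0 i)).2 fun j =>
      Finset.single_le_sum (f := fun j => ‖R x i j‖) (fun j _ => norm_nonneg _) (Finset.mem_univ j)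
  calc eLpNorm R p (μbox d) ≤ eLpNorm (∑ i, ∑ j, fun x => ‖R x i j‖) p (μbox d) :=
        eLpNorm_mono_real fun x => by simpa [Finset.sum_apply] using h x
    _ ≤ ∑ i, eLpNorm (∑ j, fun x => ‖R x i j‖) p (μbox d) :=
        eLpNorm_sum_le (fun i _ => Finset.aestronglyMeasurable_sum _ fun j _ =>
          (hR i j).norm.aestronglyMeasurable) hp
    _ ≤ ∑ i : Fin d, ∑ j : Fin d, K := by
        gcongr with i
        refine (eLpNorm_sum_le (fun j _ => (hR i j).norm.aestronglyMeasurable) hp).trans ?_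
        gcongr with j
        rw [eLpNorm_norm]
        exact hK i j
    _ = d * (d * K) := by simp

/-- The operator `biAnti` with the means of its entries removed. -/
def zeroMeanAnti (φ : Pt d → ℝ) (N : ℕ) (f : Pt d → ℝ) (u : Pt d → Vec d) : Pt d → Mat d :=
  fun x i j =>
    biAnti φ N f (comps u) i j x - ∫ y, biAnti φ N f (comps u) i j y ∂(μbox d)

lemma admissibleZero_zeroMeanAnti {φ : Pt d → ℝ} (hφ : IsRadial φ) (N : ℕ) {f : Pt d → ℝ}
    {u : Pt d → Vec d} (hf : AdmissibleScal d f) (hu : AdmissibleVec d u) (i j : Fin d) :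
    AdmissibleZero d fun x => zeroMeanAnti φ N f u x i j :=
  (admissibleScal_biAnti hφ N hf hu.comps i j).sub_integral

lemma divMat_zeroMeanAnti {φ : Pt d → ℝ} (hφ : IsRadial φ) (N : ℕ) {f : Pt d → ℝ}
    {u : Pt d → Vec d} (hf : AdmissibleScal d f) (hu : AdmissibleVec d u) (x : Pt d) (i : Fin d) :
    divMat (zeroMeanAnti φ N f u) x i = f x * u x i - ∫ y, f y * u y i ∂(μbox d) := by
  refine Eq.trans (Finset.sum_congr rfl fun j _ => ?_)
    ((Finset.sum_apply x _ _).symm.trans (congrFun (sum_pd_biAnti hφ N hf hu.comps i) x))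
  simp only [zeroMeanAnti, fderiv_sub_const, pd]

lemma zeroMeanAnti_of_add {φ : Pt d → ℝ} {N : ℕ} {f g h : Pt d → ℝ} {u v w : Pt d → Vec d}
    (hf : ∀ i j, AdmissibleScal d (biAnti φ N f (comps u) i j))
    (hg : ∀ i j, AdmissibleScal d (biAnti φ N g (comps v) i j))
    (e : biAnti φ N h (comps w) = biAnti φ N f (comps u) + biAnti φ N g (comps v)) :
    zeroMeanAnti φ N h w = zeroMeanAnti φ N f u + zeroMeanAnti φ N g v := by
  funext x i j
  simp only [zeroMeanAnti, e, Pi.add_apply]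
  rw [integral_add (hf i j).integrable (hg i j).integrable]
  ring

lemma zeroMeanAnti_of_smul {φ : Pt d → ℝ} {N : ℕ} {f g : Pt d → ℝ} {u v : Pt d → Vec d} (c : ℝ)
    (e : biAnti φ N g (comps v) = c • biAnti φ N f (comps u)) :
    zeroMeanAnti φ N g v = c • zeroMeanAnti φ N f u := by
  funext x i j
  simp only [zeroMeanAnti, e, Pi.smul_apply, smul_eq_mul, integral_const_mul]
  ring

lemma exists_zeroMeanAnti_bound {φ : Pt d → ℝ} (hφ : IsRadial φ) (N : ℕ) {p r s : ℝ≥0∞}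
    (hp : 1 ≤ p) (hr : 1 ≤ r) (hs : 1 ≤ s) (hprs : 1 / p = 1 / s + 1 / r) :
    ∃ C : ℝ≥0, ∀ f u, AdmissibleScal d f → AdmissibleVec d u → ∀ l : ℕ, 1 ≤ l →
      eLpNorm (zeroMeanAnti φ N f fun y => u fun j => (l : ℝ) * y j) p (μbox d)
        ≤ C * eLpNorm u s (μbox d) * ((l : ℝ≥0∞)⁻¹ * eLpNorm f r (μbox d)
          + (l : ℝ≥0∞) ^ (-(N : ℝ))
            * eLpNorm (fun x => iteratedFDeriv ℝ N f x) r (μbox d)) := by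
  obtain ⟨C, hC⟩ := exists_biAnti_bound hφ hp hs hprs N
  obtain ⟨K, hK⟩ := exists_scaleNorm_le d N
  refine ⟨d * (d * (2 * (C * (d * K)))), fun f u hf hu l hl => ?_⟩
  have hb : ∀ i j, AdmissibleScal d (biAnti φ N f (dil l (comps u)) i j) :=
    admissibleScal_biAnti hφ N hf fun i => (hu.comps i).dilate hl
  have hpow : (l : ℝ≥0∞) ^ (-(N : ℝ)) = (l : ℝ≥0∞)⁻¹ ^ N := by
    rw [ENNReal.rpow_neg, ENNReal.rpow_natCast, ENNReal.inv_pow]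
  rw [hpow]
  have hKf := hK r hr f hf l hl
  rw [derivNorm_zero] at hKf
  change _ ≤ _ * (_ + _ * derivNorm N f r)
  set X := (l : ℝ≥0∞)⁻¹ * eLpNorm f r (μbox d) + (l : ℝ≥0∞)⁻¹ ^ N * derivNorm N f r
  refine (eLpNorm_mat_le hp (fun i j => (hb i j).sub_integral.1.continuous)
    (K := 2 * (C * (d * eLpNorm u s (μbox d)) * (K * X))) fun i j => ?_).trans (le_of_eq ?_)
  · refine (eLpNorm_sub_integral_le (hb i j) hp).trans ?_
    gcongr
    refine (hC f hf (comps u) hu.comps l hl i j).trans ?_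
    gcongr
    exact compNorm_comps_le u s
  · push_cast
    ring

end

/-- **Improved symmetric bilinear antidivergence `R_N`** (Proposition 3.5 (ii)):
for every `N ≥ 1` there is a bilinear operator taking a smooth function `f` and a
smooth zero-mean vector field `u` to a smooth zero-mean symmetric-matrix field
with `div R_N(f,u) = f u - ⨍ f u`, extracting oscillations:
`|R_N(f, u(λ·))|_p ≤ C |u|_s (λ⁻¹ |f|_r + λ^{-N} |∇^N f|_r)` for `1/p = 1/s + 1/r`. -/
theorem improved_bilinear_antidivergence (d : ℕ) (hd : 1 ≤ d) (N : ℕ) (hN : 1 ≤ N) :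
    ∃ R : (Pt d → ℝ) → (Pt d → Vec d) → (Pt d → Mat d),
      -- mapping properties
      (∀ f u, AdmissibleScal d f → AdmissibleVec d u →
        ContDiff ℝ ((⊤:ℕ∞)) (R f u) ∧ ZPer (R f u) ∧
        (∀ i j, (∫ x in box d, R f u x i j) = 0) ∧
        (∀ x i j, R f u x i j = R f u x j i) ∧
        (∀ x i, divMat (R f u) x i = f x * u x i - ∫ y in box d, f y * u y i)) ∧
      -- bilinearity
      (∀ f g u, AdmissibleScal d f → AdmissibleScal d g → AdmissibleVec d u →
        R (f + g) u = R f u + R g u) ∧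
      (∀ (c : ℝ) f u, AdmissibleScal d f → AdmissibleVec d u →
        R (c • f) u = c • R f u) ∧
      (∀ f u v, AdmissibleScal d f → AdmissibleVec d u → AdmissibleVec d v →
        R f (u + v) = R f u + R f v) ∧
      (∀ (c : ℝ) f u, AdmissibleScal d f → AdmissibleVec d u →
        R f (c • u) = c • R f u) ∧
      -- the oscillation estimate
      (∀ p r s : ℝ≥0∞, 1 ≤ p → 1 ≤ r → 1 ≤ s → 1 / p = 1 / s + 1 / r →
        ∃ C : ℝ≥0, ∀ f u, AdmissibleScal d f → AdmissibleVec d u →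
          ∀ lam : ℕ, 1 ≤ lam →
            eLpNorm (R f (fun y => u (fun j => (lam : ℝ) * y j))) p (μbox d)
              ≤ C * eLpNorm u s (μbox d) *
                  ((lam : ℝ≥0∞)⁻¹ * eLpNorm f r (μbox d)
                    + (lam : ℝ≥0∞) ^ (-(N : ℝ))
                      * eLpNorm (fun x => iteratedFDeriv ℝ N f x) r (μbox d))) := by
  obtain ⟨φ, hφ⟩ := exists_isRadial d
  refine ⟨zeroMeanAnti φ N, fun f u hf hu => ?_, fun f g u hf hg hu => ?_, fun c f u _ _ => ?_,
    fun f u v hf hu hv => ?_, fun c f u _ _ => ?_,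
    fun p r s hp hr hs h => exists_zeroMeanAnti_bound hφ N hp hr hs h⟩
  · have h := admissibleZero_zeroMeanAnti hφ N hf hu
    refine ⟨contDiff_pi.2 fun i => contDiff_pi.2 fun j => (h i j).1.1, fun x m => ?_,
      fun i j => (h i j).2, fun x i j => ?_, divMat_zeroMeanAnti hφ N hf hu⟩
    · funext i j
      exact (h i j).1.2 x m
    · simp only [zeroMeanAnti, biAnti_symm φ N f (comps u) i j]
  · exact zeroMeanAnti_of_add (admissibleScal_biAnti hφ N hf hu.comps)
      (admissibleScal_biAnti hφ N hg hu.comps) (biAnti_add_left hφ N hf hg hu.comps)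
  · exact zeroMeanAnti_of_smul c (biAnti_smul_left φ N c f (comps u))
  · exact zeroMeanAnti_of_add (admissibleScal_biAnti hφ N hf hu.comps)
      (admissibleScal_biAnti hφ N hf hv.comps) (biAnti_add_right hφ N hf hu.comps hv.comps)
  · exact zeroMeanAnti_of_smul c (biAnti_smul_right φ N c f (comps u))

end NonNewtonian
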